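/- arXiv:2206.10712 — 8 statements merged into one kernel-verified Lean document; each statement's English description precedes it below -/
import Mathlib

section
/- Let G be a countable MIF group. For every first-order ℒ-sentence σ, the set Mod(σ) = {ℓ ∈ L(G) : G_ℓ ⊨ σ} is either meager or comeager in L(G). -/
open Set Function Pointwise

section Defs

variable {G : Type*} [Group G]

/-- A length function on a group. -/
def IsLengthFun (ℓ : G → ℕ) : Prop :=
  (∀ g : G, ℓ g = 0 ↔ g = 1) ∧ (∀ g : G, ℓ g⁻¹ = ℓ g) ∧ ∀ g h : G, ℓ (g * h) ≤ ℓ g + ℓ h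

/-- The space of length functions, topologized as a subspace of `G → ℕ`. -/
abbrev LengthFun (G : Type*) [Group G] : Type _ := {ℓ : G → ℕ // IsLengthFun ℓ}

/-- Word length with respect to a generating set `X`. -/
noncomputable def wordLength (X : Set G) (g : G) : ℕ :=
  sInf {n : ℕ | ∃ w : List G, w.length = n ∧ (∀ x ∈ w, x ∈ X ∨ x⁻¹ ∈ X) ∧ w.prod = g}

/-- A length function is a word length. -/
def IsWordLength (ℓ : G → ℕ) : Prop :=
  ∃ X : Set G, Subgroup.closure X = ⊤ ∧ ∀ g : G, ℓ g = wordLength X g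

/-- Mixed identity free group. -/
def MIF (G : Type*) [Group G] : Prop :=
  ∀ w : Monoid.Coprod G (FreeGroup Unit), w ≠ 1 →
    ∃ g : G, Monoid.Coprod.lift (MonoidHom.id G) (FreeGroup.lift fun _ => g) w ≠ 1

/-- The length function associated to a weight function `ω`. -/
noncomputable def weightLength (ω : G → ℕ) (g : G) : ℕ :=
  sInf {N : ℕ | ∃ w : List (G × Bool),
    (w.map fun p => ω p.1).sum = N ∧
    (w.map fun p => if p.2 then p.1 else p.1⁻¹).prod = g}

/-- `(ℓ, a)`-consistency of a tuple of distances. -/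
def Consistent (ℓ : G → ℕ) {n : ℕ} (a : Fin n → G) (d : Fin n → ℕ) : Prop :=
  ∀ i j : Fin n, d i ≤ ℓ ((a i)⁻¹ * a j) + d j ∧ ℓ ((a i)⁻¹ * a j) ≤ d i + d j

/-- The bi-Lipschitz preorder on length functions. -/
def Preceq (ℓ₁ ℓ₂ : G → ℕ) : Prop :=
  ∃ C : ℕ, ∀ g : G, g ≠ 1 → ℓ₁ g ≤ C * ℓ₂ g

/-- The conjugacy action of `G` on its space of length functions. -/
def conjLF (g : G) (ℓ : LengthFun G) : LengthFun G :=
  ⟨fun x => ℓ.1 (g⁻¹ * x * g), by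
    obtain ⟨h1, h2, h3⟩ := ℓ.2
    refine ⟨fun x => ?_, fun x => ?_, fun x y => ?_⟩
    · rw [h1]
      constructor
      · intro h
        have := congrArg (fun z => g * z * g⁻¹) h
        simpa [mul_assoc] using this
      · rintro rfl; simp
    · show ℓ.1 (g⁻¹ * x⁻¹ * g) = ℓ.1 (g⁻¹ * x * g)
      have h : g⁻¹ * x⁻¹ * g = (g⁻¹ * x * g)⁻¹ := by group
      rw [h, h2]
    · show ℓ.1 (g⁻¹ * (x * y) * g) ≤ ℓ.1 (g⁻¹ * x * g) + ℓ.1 (g⁻¹ * y * g)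
      have h : g⁻¹ * (x * y) * g = (g⁻¹ * x * g) * (g⁻¹ * y * g) := by group
      rw [h]
      exact h3 _ _⟩

/-- Topological transitivity of the conjugacy action on `LengthFun G`. -/
def ConjTopTransitive (G : Type*) [Group G] : Prop :=
  ∀ U V : Set (LengthFun G), IsOpen U → IsOpen V → U.Nonempty → V.Nonempty →
    ∃ g : G, ((conjLF g '' U) ∩ V).Nonempty

end Defs

/-- The language with one binary function symbol and countably many unary predicates. -/
def lengthLang : FirstOrder.Language where
  Functions := fun n => match n with | 2 => Unit | _ => Empty
  Relations := fun n => match n with | 1 => ℕ | _ => Empty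

/-- The `lengthLang`-structure on `G` associated to a length function `ℓ`. -/
def lengthStructure {G : Type*} [Group G] (ℓ : G → ℕ) : lengthLang.Structure G where
  funMap {n} f x :=
    match n, f, x with
    | 2, _, x => x 0 * x 1
  RelMap {n} r x :=
    match n, r, x with
    | 1, i, x => ℓ (x 0) = i

section FreeProduct

open Monoid
open scoped commutatorElement

/-- If the `i`-th factor has at least three elements, every nontrivial element of a free product
is conjugate to a reduced word that begins and ends in this factor. -/
theorem CoprodI.exists_conj_neWord {ι : Type*} {H : ι → Type*} [∀ i, Group (H i)] (i : ι)
    (hi : ∀ y : H i, ∃ z : H i, z ≠ 1 ∧ z * y ≠ 1) (w : CoprodI H) (hw : w ≠ 1) :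
    ∃ (u : CoprodI H) (v : CoprodI.NeWord H i i), v.prod = u * w * u⁻¹ := by
  classical
  have key : ∀ k (w : CoprodI.NeWord H i k),
      ∃ (u : CoprodI H) (v : CoprodI.NeWord H i i), v.prod = u * w.prod * u⁻¹ := by
    intro k w
    by_cases hk : k = i
    · subst hk
      exact ⟨1, w, by simp⟩
    · obtain ⟨z, hz, hzw⟩ := hi w.head
      exact ⟨CoprodI.of z, (w.mulHead z hzw).append hk (.singleton z⁻¹ (inv_ne_one.mpr hz)),
        by simp⟩
  obtain ⟨j, k, w, rfl⟩ : ∃ (j k : ι) (w' : CoprodI.NeWord H j k), w'.prod = w := by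
    obtain ⟨j, k, w', h⟩ := CoprodI.NeWord.of_word (CoprodI.Word.equiv w) (by
      intro h
      apply hw
      rw [← CoprodI.Word.equiv.symm_apply_apply w, h]
      exact CoprodI.Word.prod_empty)
    refine ⟨j, k, w', ?_⟩
    rw [CoprodI.NeWord.prod, h]
    exact CoprodI.Word.equiv.symm_apply_apply w
  by_cases hj : j = i
  · subst hj
    exact key k w
  by_cases hk : k = i
  · subst hk
    obtain ⟨u, v, hv⟩ := key j w.inv
    refine ⟨u, v.inv, ?_⟩
    rw [CoprodI.NeWord.inv_prod, hv, CoprodI.NeWord.inv_prod]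
    group
  · obtain ⟨z, hz, -⟩ := hi 1
    exact ⟨CoprodI.of z, ((CoprodI.NeWord.singleton z hz).append (Ne.symm hj) w).append hk
      (.singleton z⁻¹ (inv_ne_one.mpr hz)), by simp⟩

theorem CoprodI.neWord_prod_ne_one {ι : Type*} {H : ι → Type*} [∀ i, Group (H i)] {i j : ι}
    (w : CoprodI.NeWord H i j) : w.prod ≠ 1 := by
  classical
  intro h
  apply w.toList_ne_nil
  have : w.toWord = CoprodI.Word.empty := by
    apply CoprodI.Word.equiv.symm.injective
    exact h.trans CoprodI.Word.prod_empty.symm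
  exact congrArg CoprodI.Word.toList this

/-- In a free product with two nontrivial factors, one of which has at least three elements, any
two nontrivial elements have conjugates which do not commute. -/
theorem CoprodI.exists_commutator_ne_one {ι : Type*} {H : ι → Type*} [∀ i, Group (H i)] {i j : ι}
    (hij : i ≠ j) (hi : ∀ y : H i, ∃ z : H i, z ≠ 1 ∧ z * y ≠ 1) (hj : ∃ a : H j, a ≠ 1)
    (w₁ w₂ : CoprodI H) (h₁ : w₁ ≠ 1) (h₂ : w₂ ≠ 1) :
    ∃ u v : CoprodI H, ⁅u * w₁ * u⁻¹, v * w₂ * v⁻¹⁆ ≠ 1 := by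
  obtain ⟨a, ha⟩ := hj
  obtain ⟨u, w₁', hu⟩ := CoprodI.exists_conj_neWord i hi w₁ h₁
  obtain ⟨v, w₂', hv⟩ := CoprodI.exists_conj_neWord i hi w₂ h₂
  let w₃ : CoprodI.NeWord H j j := ((CoprodI.NeWord.singleton a ha).append hij.symm w₂').append hij
      (.singleton a⁻¹ (inv_ne_one.mpr ha))
  refine ⟨u, CoprodI.of a * v, ?_⟩
  have h := CoprodI.neWord_prod_ne_one
    (((w₁'.append hij w₃).append hij.symm w₁'.inv).append hij w₃.inv)
  simpa [w₃, hu, hv, commutatorElement_def, mul_assoc] using h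

/-- The two factors of `G ∗ ⟨x⟩`, as a family of groups. -/
def mixedFactor (G : Type) : Bool → Type
  | true => G
  | false => FreeGroup Unit

instance (G : Type) [Group G] : ∀ b, Group (mixedFactor G b)
  | true => inferInstanceAs (Group G)
  | false => inferInstanceAs (Group (FreeGroup Unit))

/-- The inclusions of the two factors of `G ∗ ⟨x⟩`. -/
def mixedFactorHom (G : Type) [Group G] : ∀ b, mixedFactor G b →* Coprod G (FreeGroup Unit)
  | true => (Coprod.inl : G →* Coprod G (FreeGroup Unit))
  | false => (Coprod.inr : FreeGroup Unit →* Coprod G (FreeGroup Unit))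

/-- The identification of the two constructions of `G ∗ ⟨x⟩` in Mathlib. -/
def mixedEquiv (G : Type) [Group G] :
    Coprod G (FreeGroup Unit) ≃* CoprodI (mixedFactor G) :=
  MonoidHom.toMulEquiv
    (Coprod.lift (CoprodI.of (M := mixedFactor G) (i := true))
      (CoprodI.of (M := mixedFactor G) (i := false)))
    (CoprodI.lift (mixedFactorHom G))
    (by
      apply Coprod.hom_ext
      · apply MonoidHom.ext
        intro g
        exact CoprodI.lift_of (mixedFactorHom G) (i := true) g
      · apply MonoidHom.ext
        intro g
        exact CoprodI.lift_of (mixedFactorHom G) (i := false) g)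
    (by
      apply CoprodI.ext_hom
      rintro (_ | _)
      · apply MonoidHom.ext
        intro g
        simp only [MonoidHom.comp_apply]
        rw [CoprodI.lift_of]
        rfl
      · apply MonoidHom.ext
        intro g
        simp only [MonoidHom.comp_apply]
        rw [CoprodI.lift_of]
        rfl)

theorem FreeGroup.unit_exists_ne_one (y : FreeGroup Unit) :
    ∃ z : FreeGroup Unit, z ≠ 1 ∧ z * y ≠ 1 := by
  have h1 : FreeGroup.of () ≠ 1 := FreeGroup.of_ne_one ()
  by_cases h : FreeGroup.of () * y = 1
  · refine ⟨FreeGroup.of () ^ 2, fun h2 => ?_, fun h2 => ?_⟩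
    · have := congrArg (FreeGroup.lift fun _ => Multiplicative.ofAdd (1 : ℤ)) h2
      simp only [map_pow, FreeGroup.lift_apply_of] at this
      exact absurd (congrArg Multiplicative.toAdd this) (by simp)
    · apply h1
      rw [pow_two, mul_assoc, h, mul_one] at h2
      exact h2
  · exact ⟨_, h1, h⟩

/-- Evaluation of an element of `G ∗ ⟨x⟩` at `g`. -/
abbrev mixedEval {G : Type*} [Group G] (g : G) : Coprod G (FreeGroup Unit) →* G :=
  Coprod.lift (MonoidHom.id G) (FreeGroup.lift fun _ => g)

theorem MIF.exists_ne_one {G : Type} [Group G] (hG : MIF G) : ∃ a : G, a ≠ 1 := by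
  obtain ⟨g, hg⟩ := hG (Coprod.inr (FreeGroup.of ())) fun h =>
    FreeGroup.of_ne_one () (Coprod.inr_injective (h.trans (map_one _).symm))
  exact ⟨_, hg⟩

/-- Any two nontrivial mixed words over an MIF group are simultaneously nontrivial at the
non-solutions of a single nontrivial mixed word. -/
theorem MIF.exists_commutator_ne_one {G : Type} [Group G] (hG : MIF G)
    (w₁ w₂ : Coprod G (FreeGroup Unit)) (h₁ : w₁ ≠ 1) (h₂ : w₂ ≠ 1) :
    ∃ u v : Coprod G (FreeGroup Unit), ⁅u * w₁ * u⁻¹, v * w₂ * v⁻¹⁆ ≠ 1 := by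
  let e := mixedEquiv G
  obtain ⟨u, v, h⟩ := CoprodI.exists_commutator_ne_one (H := mixedFactor G)
    (i := false) (j := true) (by simp) FreeGroup.unit_exists_ne_one hG.exists_ne_one (e w₁) (e w₂)
    (by simpa using h₁) (by simpa using h₂)
  refine ⟨e.symm u, e.symm v, fun h0 => h ?_⟩
  have := congrArg e h0
  simpa [commutatorElement_def] using this

/-- Finitely many nontrivial mixed words over an MIF group are simultaneously nontrivial at some
element. -/
theorem MIF.exists_forall_ne_one {G : Type} [Group G] (hG : MIF G)
    (S : Set (Coprod G (FreeGroup Unit))) (hS : S.Finite) (h1 : ∀ w ∈ S, w ≠ 1) :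
    ∃ g : G, ∀ w ∈ S, mixedEval g w ≠ 1 := by
  suffices ∃ W : Coprod G (FreeGroup Unit), W ≠ 1 ∧
      ∀ g : G, mixedEval g W ≠ 1 → ∀ w ∈ S, mixedEval g w ≠ 1 by
    obtain ⟨W, hW, h⟩ := this
    obtain ⟨g, hg⟩ := hG W hW
    exact ⟨g, h g hg⟩
  induction S, hS using Set.Finite.induction_on with
  | empty =>
    obtain ⟨a, ha⟩ := hG.exists_ne_one
    exact ⟨Coprod.inl a, fun h => ha (Coprod.inl_injective (h.trans (map_one _).symm)), by simp⟩
  | @insert w S _ _ ih =>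
    obtain ⟨W, hW, h⟩ := ih fun v hv => h1 v (Set.mem_insert_of_mem _ hv)
    obtain ⟨u, v, huv⟩ := hG.exists_commutator_ne_one w W (h1 w (Set.mem_insert _ _)) hW
    refine ⟨_, huv, fun g hg => ?_⟩
    rw [Set.forall_mem_insert]
    constructor
    · intro h0
      apply hg
      simp only [map_commutatorElement, map_mul, map_inv, h0]
      simp
    · apply h g
      intro h0
      apply hg
      simp only [map_commutatorElement, map_mul, map_inv, h0]
      simp

end FreeProduct

section ZeroOne

/-- The topological zero-one law for a topologically transitive action by homeomorphisms. -/
theorem isMeagre_or_mem_residual {Γ X : Type*} [Countable Γ] [TopologicalSpace X] (T : Γ → X ≃ₜ X)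
    (hT : ∀ U V : Set X, IsOpen U → IsOpen V → U.Nonempty → V.Nonempty →
      ∃ g, (T g '' U ∩ V).Nonempty)
    (A : Set X) (hA : BaireMeasurableSet A) (hinv : ∀ g x, T g x ∈ A ↔ x ∈ A) :
    IsMeagre A ∨ A ∈ residual X := by
  obtain ⟨U, hU, hAU⟩ := hA.residualEq_isOpen
  rcases U.eq_empty_or_nonempty with rfl | hne
  · left
    filter_upwards [hAU] with x hx
    intro hxA
    exact hx.mp hxA
  · right
    have hopen : IsOpen (⋃ g, T g '' U) :=
      isOpen_iUnion fun g => (T g).isOpenMap _ hU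
    have hdense : Dense (⋃ g, T g '' U) := by
      rw [dense_iff_inter_open]
      intro V hV hVne
      obtain ⟨g, x, hx, hxV⟩ := hT U V hU hV hne hVne
      exact ⟨x, hxV, Set.mem_iUnion.mpr ⟨g, hx⟩⟩
    have hres : ∀ g, ∀ᶠ x in residual X, (T g).symm x ∈ U → (T g).symm x ∈ A := by
      intro g
      have := tendsto_residual_of_isOpenMap (T g).symm.continuous (T g).symm.isOpenMap
      exact this.eventually (hAU.mono fun x hx hxU => hx.mpr hxU)
    filter_upwards [residual_of_dense_open hopen hdense, eventually_countable_forall.mpr hres]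
      with x hx hx'
    obtain ⟨g, y, hy, rfl⟩ := Set.mem_iUnion.mp hx
    rw [hinv]
    simpa using hx' g (by simpa using hy)

variable {G : Type*} [Group G]

theorem conjLF_apply (g : G) (ℓ : LengthFun G) (x : G) : (conjLF g ℓ).1 x = ℓ.1 (g⁻¹ * x * g) :=
  rfl

theorem continuous_conjLF (g : G) : Continuous (conjLF g) :=
  continuous_induced_rng.mpr <| continuous_pi fun x =>
    (continuous_apply (g⁻¹ * x * g)).comp continuous_subtype_val

theorem conjLF_conjLF_of_mul_eq_one {g h : G} (hgh : h * g = 1) (ℓ : LengthFun G) :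
    conjLF g (conjLF h ℓ) = ℓ := by
  obtain rfl : h = g⁻¹ := eq_inv_of_mul_eq_one_left hgh
  ext x
  simp [conjLF_apply, mul_assoc]

/-- Conjugation by an element of the group, as a homeomorphism of the space of length functions. -/
def conjHomeo (g : G) : LengthFun G ≃ₜ LengthFun G where
  toFun := conjLF g
  invFun := conjLF g⁻¹
  left_inv := conjLF_conjLF_of_mul_eq_one (by simp)
  right_inv := conjLF_conjLF_of_mul_eq_one (by simp)
  continuous_toFun := continuous_conjLF g
  continuous_invFun := continuous_conjLF g⁻¹

theorem realize_conjLF_iff (g : G) (ℓ : LengthFun G) (σ : lengthLang.Sentence) :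
    @FirstOrder.Language.Sentence.Realize lengthLang G (lengthStructure (conjLF g ℓ).1) σ ↔
      @FirstOrder.Language.Sentence.Realize lengthLang G (lengthStructure ℓ.1) σ := by
  let e : @FirstOrder.Language.Equiv lengthLang G G (lengthStructure ℓ.1)
      (lengthStructure (conjLF g ℓ).1) :=
    @FirstOrder.Language.Equiv.mk lengthLang G G (lengthStructure ℓ.1)
      (lengthStructure (conjLF g ℓ).1) (MulAut.conj g).toEquiv
      (fun {n} f x => match n, f with
        | 2, _ => map_mul (MulAut.conj g) (x 0) (x 1))
      (fun {n} r x => match n, r with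
        | 1, i => by
          show ℓ.1 (g⁻¹ * (g * x 0 * g⁻¹) * g) = i ↔ ℓ.1 (x 0) = i
          simp [mul_assoc])
  exact (@FirstOrder.Language.StrongHomClass.realize_sentence lengthLang G G (lengthStructure ℓ.1)
    (lengthStructure (conjLF g ℓ).1) _ _ _ e σ).symm

theorem term_realize_lengthStructure {α : Type*} (t : lengthLang.Term α) (v : α → G)
    (ℓ ℓ' : G → ℕ) :
    @FirstOrder.Language.Term.realize lengthLang G (lengthStructure ℓ) α v t =
      @FirstOrder.Language.Term.realize lengthLang G (lengthStructure ℓ') α v t := by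
  induction t with
  | var => rfl
  | @func n f ts ih =>
    match n, f with
    | 2, _ => exact congrArg₂ (· * ·) (ih 0) (ih 1)

theorem baireMeasurableSet_realize [Countable G] {α : Type*} {n : ℕ}
    (φ : lengthLang.BoundedFormula α n) (v : α → G) (xs : Fin n → G) :
    BaireMeasurableSet {ℓ : LengthFun G |
      @FirstOrder.Language.BoundedFormula.Realize lengthLang G (lengthStructure ℓ.1) α n φ v xs} := by
  induction φ with
  | falsum =>
    exact isOpen_empty.baireMeasurableSet
  | equal t₁ t₂ =>
    apply IsOpen.baireMeasurableSet
    convert isOpen_const (X := LengthFun G) using 1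
    ext ℓ
    simp only [Set.mem_ofPred_eq, FirstOrder.Language.BoundedFormula.Realize]
    rw [term_realize_lengthStructure t₁ _ ℓ.1 (fun _ => 0),
      term_realize_lengthStructure t₂ _ ℓ.1 (fun _ => 0)]
  | @rel n k r ts =>
    match k, r with
    | 1, (i : ℕ) =>
      let x : G := @FirstOrder.Language.Term.realize lengthLang G (lengthStructure fun _ => 0) _
        (Sum.elim v xs) (ts 0)
      have : IsOpen {ℓ : LengthFun G | ℓ.1 x = i} :=
        (isOpen_discrete ({i} : Set ℕ)).preimage (f := fun ℓ : LengthFun G => ℓ.1 x)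
          ((continuous_apply x).comp continuous_subtype_val)
      convert this.baireMeasurableSet using 1
      ext ℓ
      exact iff_of_eq (congrArg (fun y => ℓ.1 y = i)
        (term_realize_lengthStructure (ts 0) (Sum.elim v xs) ℓ.1 fun _ => 0))
  | imp φ ψ hφ hψ =>
    convert (hφ xs).compl.union (hψ xs) using 1
    ext ℓ
    exact imp_iff_not_or
  | all φ h =>
    convert BaireMeasurableSet.iInter fun a => h (Fin.snoc xs a) using 1
    ext ℓ
    simp only [Set.mem_iInter]
    rfl

end ZeroOne

section Transitivity

open Monoid

variable {G : Type*} [Group G]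

/-- The basic neighbourhoods of a length function. -/
theorem LengthFun.exists_finite_of_isOpen {U : Set (LengthFun G)} (hU : IsOpen U)
    {ℓ₀ : LengthFun G} (h₀ : ℓ₀ ∈ U) :
    ∃ F : Set G, F.Finite ∧ ∀ ℓ : LengthFun G, (∀ x ∈ F, ℓ.1 x = ℓ₀.1 x) → ℓ ∈ U := by
  obtain ⟨V, hV, rfl⟩ := isOpen_induced_iff.mp hU
  obtain ⟨I, u, hu, hIu⟩ := isOpen_pi_iff.mp hV ℓ₀.1 h₀
  refine ⟨I, I.finite_toSet, fun ℓ hℓ => hIu fun x hx => ?_⟩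
  rw [hℓ x hx]
  exact (hu x hx).2

/-- The length of an element as the minimal cost of an expression for it, in terms of letters
`k : K` with values `v k` and costs `c k`. -/
noncomputable def costLength {K : Type*} (v : K → G) (c : K → ℕ) (h : G) : ℕ :=
  sInf {n | ∃ L : List K, (L.map c).sum = n ∧ (L.map v).prod = h}

section CostLength

variable {K : Type*} {v : K → G} {c : K → ℕ}

theorem costLength_prod_le (L : List K) : costLength v c (L.map v).prod ≤ (L.map c).sum :=
  Nat.sInf_le ⟨L, rfl, rfl⟩

theorem exists_costLength_eq (hv : Surjective v) (h : G) :
    ∃ L : List K, (L.map c).sum = costLength v c h ∧ (L.map v).prod = h := by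
  obtain ⟨k, hk⟩ := hv h
  exact Nat.sInf_mem (s := {n | ∃ L : List K, (L.map c).sum = n ∧ (L.map v).prod = h})
    ⟨_, [k], rfl, by simpa using hk⟩

theorem isLengthFun_costLength (hv : Surjective v) (hc : ∀ k, c k ≠ 0) (i : K → K)
    (hvi : ∀ k, v (i k) = (v k)⁻¹) (hci : ∀ k, c (i k) = c k) :
    IsLengthFun (costLength v c) := by
  have hinv : ∀ g, costLength v c g⁻¹ ≤ costLength v c g := by
    intro g
    obtain ⟨L, hL, rfl⟩ := exists_costLength_eq (c := c) hv g
    rw [← hL]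
    have h1 : ((L.map i).reverse.map v).prod = (L.map v).prod⁻¹ := by
      rw [List.prod_inv_reverse, List.map_reverse]
      simp [Function.comp_def, hvi]
    have h2 : ((L.map i).reverse.map c).sum = (L.map c).sum := by
      rw [List.map_reverse, List.sum_reverse]
      simp [Function.comp_def, hci]
    rw [← h1, ← h2]
    exact costLength_prod_le _
  refine ⟨fun g => ⟨fun hg => ?_, ?_⟩, fun g => ?_, fun g h => ?_⟩
  · obtain ⟨L, hL, rfl⟩ := exists_costLength_eq (c := c) hv g
    cases L with
    | nil => simp
    | cons k L =>
      rw [hg] at hL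
      exact absurd hL (by simp [hc k])
  · rintro rfl
    exact Nat.le_zero.mp (costLength_prod_le (v := v) (c := c) [])
  · exact (hinv g).antisymm (by simpa using hinv g⁻¹)
  · obtain ⟨L, hL, rfl⟩ := exists_costLength_eq (c := c) hv g
    obtain ⟨L', hL', rfl⟩ := exists_costLength_eq (c := c) hv h
    rw [← hL, ← hL', ← List.prod_append, ← List.map_append, ← List.sum_append, ← List.map_append]
    exact costLength_prod_le _

end CostLength

theorem List.length_le_sum_map {K : Type*} {c : K → ℕ} (hc : ∀ k, c k ≠ 0) (L : List K) :
    L.length ≤ (L.map c).sum := by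
  simpa using List.length_le_sum_of_one_le (L.map c) (by
    intro n hn
    obtain ⟨k, -, rfl⟩ := List.mem_map.mp hn
    exact Nat.one_le_iff_ne_zero.mpr (hc k))

theorem IsLengthFun.prod_le_sum {ℓ : G → ℕ} (hℓ : IsLengthFun ℓ) (L : List G) :
    ℓ L.prod ≤ (L.map ℓ).sum := by
  induction L with
  | nil => simp [(hℓ.1 1).mpr rfl]
  | cons g L ih =>
    simp only [List.prod_cons, List.map_cons, List.sum_cons]
    exact (hℓ.2.2 _ _).trans (by lia)

/-- The letter `f` of the copy of `G` in `G ∗ ⟨x⟩` given by `G` (for `true`) or by the conjugate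
`x G x⁻¹` (for `false`). -/
def mixedLetter (p : Bool × G) : Coprod G (FreeGroup Unit) :=
  bif p.1 then Coprod.inl p.2 else
    Coprod.inr (FreeGroup.of ()) * Coprod.inl p.2 * (Coprod.inr (FreeGroup.of ()))⁻¹

/-- The permutation representation of `G ∗ ⟨x⟩` on two copies of `G` in which `G` acts by
translation on one copy and `x` exchanges the two copies. -/
def swapRep (G : Type*) [Group G] : Coprod G (FreeGroup Unit) →* Equiv.Perm (Bool × G) :=
  Coprod.lift
    { toFun := fun f =>
        { toFun := fun p => (p.1, bif p.1 then f * p.2 else p.2)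
          invFun := fun p => (p.1, bif p.1 then f⁻¹ * p.2 else p.2)
          left_inv := by rintro ⟨_ | _, h⟩ <;> simp
          right_inv := by rintro ⟨_ | _, h⟩ <;> simp }
      map_one' := by ext ⟨_ | _, h⟩ <;> simp
      map_mul' := by intro f f'; ext ⟨_ | _, h⟩ <;> simp [mul_assoc] }
    (FreeGroup.lift fun _ => Equiv.boolNot.prodCongr (Equiv.refl G))

theorem swapRep_mixedLetter (p : Bool × G) (b : Bool) (h : G) :
    swapRep G (mixedLetter p) (b, h) = (b, (if p.1 = b then p.2 else 1) * h) := by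
  obtain ⟨_ | _, f⟩ := p <;> cases b <;>
    simp [swapRep, mixedLetter, Equiv.Perm.mul_apply, Equiv.Perm.inv_def]

theorem swapRep_prod (L : List (Bool × G)) (b : Bool) (h : G) :
    swapRep G (L.map mixedLetter).prod (b, h) =
      (b, (L.map fun p => if p.1 = b then p.2 else 1).prod * h) := by
  induction L with
  | nil => simp
  | cons p L ih =>
    simp only [List.map_cons, List.prod_cons, map_mul, Equiv.Perm.mul_apply]
    rw [ih, swapRep_mixedLetter, mul_assoc]

theorem mixedEval_mixedLetter (g : G) (p : Bool × G) :
    mixedEval g (mixedLetter p) = bif p.1 then p.2 else g * p.2 * g⁻¹ := by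
  obtain ⟨_ | _, f⟩ := p <;> simp [mixedLetter]

/-- Any two length functions agree on a finite set `F`, up to conjugating one of the copies of `F`,
with a single length function. -/
theorem MIF.exists_lengthFun {G : Type} [Group G] (hG : MIF G) (ℓ : Bool → LengthFun G)
    (F : Set G) (hF : F.Finite) (hF1 : 1 ∉ F) (hFinv : ∀ f ∈ F, f⁻¹ ∈ F) :
    ∃ (g : G) (ℓ' : LengthFun G), ∀ f ∈ F,
      ℓ'.1 f = (ℓ true).1 f ∧ ℓ'.1 (g * f * g⁻¹) = (ℓ false).1 f := by
  classical
  obtain ⟨M, hM⟩ : ∃ M, ∀ b, ∀ f ∈ F, (ℓ b).1 f ≤ M := by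
    obtain ⟨M₁, h₁⟩ := (hF.image (ℓ true).1).bddAbove
    obtain ⟨M₂, h₂⟩ := (hF.image (ℓ false).1).bddAbove
    refine ⟨max M₁ M₂, ?_⟩
    rintro (_ | _) f hf
    · exact (h₂ (Set.mem_image_of_mem _ hf)).trans (le_max_right _ _)
    · exact (h₁ (Set.mem_image_of_mem _ hf)).trans (le_max_left _ _)
  let A : Set (Bool × G) := Set.univ ×ˢ F
  have hA : A.Finite := Set.finite_univ.prod hF
  let B : Set (List (Bool × G)) := {L | L.length ≤ M ∧ ∀ p ∈ L, p ∈ A}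
  have hB : B.Finite := by
    have : Finite A := hA
    refine ((List.finite_length_le A M).image (List.map Subtype.val)).subset ?_
    rintro L ⟨hL, hLA⟩
    exact ⟨L.attach.map fun p => ⟨p.1, hLA p.1 p.2⟩, by simpa using hL, by
      rw [List.map_map]
      exact List.attach_map_subtype_val L⟩
  obtain ⟨g, hg⟩ := hG.exists_forall_ne_one
    (Set.image2 (fun L p => (L.map mixedLetter).prod * (mixedLetter p)⁻¹) B A \ {1})
    ((hB.image2 _ hA).subset Set.sdiff_subset) fun w hw => hw.2
  have hlift : ∀ L ∈ B, ∀ p ∈ A, (L.map fun q => mixedEval g (mixedLetter q)).prod =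
      mixedEval g (mixedLetter p) → (L.map mixedLetter).prod = mixedLetter p := by
    intro L hL p hp h
    by_contra hne
    refine hg _ ⟨⟨L, hL, p, hp, rfl⟩, fun h1 => hne (mul_inv_eq_one.mp h1)⟩ ?_
    rw [map_mul, map_inv, map_list_prod, List.map_map, mul_inv_eq_one]
    exact h
  let v : Bool × G → G := fun p => mixedEval g (mixedLetter p)
  let c : Bool × G → ℕ := fun p => if p.2 ∈ F then (ℓ p.1).1 p.2 else M + 1
  have hc : ∀ p, c p ≠ 0 := by
    intro p
    by_cases hp : p.2 ∈ F
    · simp only [c, if_pos hp, ne_eq, (ℓ p.1).2.1]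
      rintro h
      exact hF1 (h ▸ hp)
    · simp [c, hp]
  have hv : Surjective v := fun h => ⟨(true, h), by simp [v, mixedEval_mixedLetter]⟩
  have hlen : IsLengthFun (costLength v c) := by
    refine isLengthFun_costLength hv hc (fun p => (p.1, p.2⁻¹)) ?_ ?_
    · rintro ⟨_ | _, f⟩ <;> simp [v, mixedEval_mixedLetter, mul_assoc]
    · rintro ⟨b, f⟩
      have : f⁻¹ ∈ F ↔ f ∈ F := ⟨fun h => by simpa using hFinv _ h, hFinv f⟩
      simp only [c, this, (ℓ b).2.2.1]
  have hval : ∀ b, ∀ f ∈ F, costLength v c (v (b, f)) = (ℓ b).1 f := by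
    intro b f hf
    apply le_antisymm
    · simpa [c, hf] using costLength_prod_le (v := v) (c := c) [(b, f)]
    by_contra! hlt
    obtain ⟨L, hLc, hLv⟩ := exists_costLength_eq (c := c) hv (v (b, f))
    rw [← hLc] at hlt
    have hLA : ∀ p ∈ L, p ∈ A := by
      intro p hp
      refine ⟨Set.mem_univ _, ?_⟩
      by_contra hpF
      have h1 : c p ≤ (L.map c).sum := List.single_le_sum (by simp) _ (List.mem_map_of_mem hp)
      have h2 : c p = M + 1 := if_neg hpF
      have := hM b f hf
      lia
    have hLB : L ∈ B := by
      refine ⟨?_, hLA⟩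
      have := List.length_le_sum_map hc L
      have := hM b f hf
      lia
    have heq := congrArg (fun w => (swapRep G w (b, 1)).2) (hlift L hLB (b, f) ⟨trivial, hf⟩ hLv)
    simp only [swapRep_prod, swapRep_mixedLetter, mul_one, if_true] at heq
    rw [← heq] at hlt
    refine hlt.not_ge (((ℓ b).2.prod_le_sum _).trans ?_)
    rw [List.map_map]
    refine List.sum_le_sum fun p hp => ?_
    by_cases hpb : p.1 = b
    · simp [c, (hLA p hp).2, hpb]
    · simp [hpb, ((ℓ b).2.1 1).mpr rfl]
  refine ⟨g, ⟨_, hlen⟩, fun f hf => ⟨?_, ?_⟩⟩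
  · simpa [v, mixedEval_mixedLetter] using hval true f hf
  · simpa [v, mixedEval_mixedLetter] using hval false f hf

theorem MIF.conjTopTransitive {G : Type} [Group G] (hG : MIF G) : ConjTopTransitive G := by
  rintro U V hU hV ⟨ℓU, hℓU⟩ ⟨ℓV, hℓV⟩
  obtain ⟨F₁, hF₁, h₁⟩ := LengthFun.exists_finite_of_isOpen hU hℓU
  obtain ⟨F₂, hF₂, h₂⟩ := LengthFun.exists_finite_of_isOpen hV hℓV
  obtain ⟨g, ℓ, h⟩ := hG.exists_lengthFun (fun b => bif b then ℓV else ℓU)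
    (((F₁ ∪ F₂) ∪ (F₁ ∪ F₂)⁻¹) \ {1})
    (((hF₁.union hF₂).union (hF₁.union hF₂).inv).subset Set.sdiff_subset) (by simp) (by
      rintro f ⟨hf, hf1⟩
      refine ⟨?_, by simpa using hf1⟩
      rw [← Set.mem_inv, Set.union_inv, inv_inv, Set.union_comm]
      exact hf)
  have hone : ∀ ℓ : LengthFun G, ℓ.1 1 = 0 := fun ℓ => (ℓ.2.1 1).mpr rfl
  refine ⟨g, ℓ, ⟨conjLF g⁻¹ ℓ, h₁ _ fun x hx => ?_, conjLF_conjLF_of_mul_eq_one (by simp) ℓ⟩,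
    h₂ _ fun x hx => ?_⟩
  · rw [conjLF_apply, inv_inv]
    by_cases hx1 : x = 1
    · simp [hx1, hone]
    · exact (h x ⟨.inl (.inl hx), hx1⟩).2
  · by_cases hx1 : x = 1
    · simp [hx1, hone]
    · exact (h x ⟨.inl (.inr hx), hx1⟩).1

end Transitivity

theorem stmt7 (G : Type) [Group G] [Countable G] (hG : MIF G)
    (σ : lengthLang.Sentence) :
    IsMeagre {ℓ : LengthFun G | @FirstOrder.Language.Sentence.Realize lengthLang G (lengthStructure ℓ.1) σ} ∨
      {ℓ : LengthFun G | @FirstOrder.Language.Sentence.Realize lengthLang G (lengthStructure ℓ.1) σ} ∈ residual (LengthFun G) :=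
  isMeagre_or_mem_residual (conjHomeo (G := G)) hG.conjTopTransitive _
    (baireMeasurableSet_realize σ _ _) fun g ℓ => realize_conjLF_iff g ℓ σ
end

section
/- Let G be a countably infinite group, ℓ ∈ L(G), and F a finite subset of G with F⁻¹ = F and 1 ∈ F. Let ω: G → ℕ be the weight function defined by ω(g) = ℓ(g) for g ∈ F and ω(g) = M_g for g ∉ F, where the values M_g are natural numbers satisfying M_g > max{ℓ(f) : f ∈ F} for all g ∉ F. Then the associated length function ℓ_ω satisfies ℓ_ω(f) = ℓ(f) for all f ∈ F, i.e., ℓ_ω ∈ W(ℓ,F). -/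
open Set Function Pointwise

/-- A length function of a signed word is at most the sum of the lengths of its letters. -/
theorem IsLengthFun.apply_signed_prod_le {G : Type*} [Group G] {ℓ : G → ℕ} (hℓ : IsLengthFun ℓ)
    (w : List (G × Bool)) :
    ℓ (w.map fun p => if p.2 then p.1 else p.1⁻¹).prod ≤ (w.map fun p => ℓ p.1).sum := by
  obtain ⟨h_one, h_inv, h_mul⟩ := hℓ
  induction w with
  | nil => simp [h_one]
  | cons p w ih =>
    simp only [List.map_cons, List.prod_cons, List.sum_cons]
    refine (h_mul _ _).trans (Nat.add_le_add ?_ ih)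
    split_ifs
    · exact le_rfl
    · exact (h_inv _).le

theorem stmt8 (G : Type) [Group G] [Countable G] [Infinite G]
    (ℓ : LengthFun G) (F : Set G) (hFfin : F.Finite) (hFinv : F⁻¹ = F) (h1F : (1 : G) ∈ F)
    (ω : G → ℕ) (hωF : ∀ g ∈ F, ω g = ℓ.1 g)
    (hωM : ∀ g ∉ F, ∀ f ∈ F, ℓ.1 f < ω g) :
    ∀ f ∈ F, weightLength ω f = ℓ.1 f := by
  intro f hf
  refine le_antisymm (Nat.sInf_le ⟨[(f, true)], by simp [hωF f hf], by simp⟩) ?_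
  refine le_csInf ⟨_, [(f, true)], rfl, by simp⟩ ?_
  rintro N ⟨w, rfl, hw⟩
  by_cases h : ∀ p ∈ w, p.1 ∈ F
  · rw [List.map_congr_left fun p hp => hωF p.1 (h p hp), ← hw]
    exact ℓ.2.apply_signed_prod_le w
  · push Not at h
    obtain ⟨p, hp, hpF⟩ := h
    exact (hωM p.1 hpF f hf).le.trans
      (List.single_le_sum (fun _ _ => Nat.zero_le _) _ (List.mem_map_of_mem hp))
end

section
/- If G is a countably infinite group, then the set of bounded length functions and the set of proper length functions are both dense in L(G); in particular, the set of unbounded length functions is dense in L(G). -/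
open Set Function Pointwise

theorem LengthFun.dense_of_agree_on_finset {G : Type*} [Group G] {S : Set (LengthFun G)}
    (h : ∀ (ℓ : LengthFun G) (F : Finset G), ∃ ℓ' ∈ S, ∀ g ∈ F, ℓ'.1 g = ℓ.1 g) : Dense S := by
  intro ℓ
  rw [mem_closure_iff]
  rintro U hU hℓ
  obtain ⟨V, hV, rfl⟩ := isOpen_induced_iff.1 hU
  obtain ⟨F, u, hu, hF⟩ := isOpen_pi_iff.1 hV ℓ.1 hℓ
  obtain ⟨ℓ', hS, hℓ'⟩ := h ℓ F
  refine ⟨ℓ', hF fun g hg => ?_, hS⟩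
  rw [hℓ' g hg]
  exact (hu g hg).2

theorem IsLengthFun.min_const {G : Type*} [Group G] {ℓ : G → ℕ} (h : IsLengthFun ℓ) {C : ℕ}
    (hC : 0 < C) : IsLengthFun fun g => min (ℓ g) C := by
  obtain ⟨h1, h2, h3⟩ := h
  refine ⟨fun g => ?_, fun g => ?_, fun g k => ?_⟩
  · rw [← h1]
    dsimp only
    omega
  · simp only [h2]
  · have := h3 g k
    dsimp only
    omega

/-- The largest function bounded by `ω` that vanishes at `1` and is subadditive. -/
noncomputable def listLength {G : Type*} [Group G] (ω : G → ℕ) (g : G) : ℕ :=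
  sInf {N : ℕ | ∃ w : List G, (w.map ω).sum = N ∧ w.prod = g}

section ListLength

variable {G : Type*} [Group G] {ω : G → ℕ}

theorem exists_list_sum_eq_listLength (ω : G → ℕ) (g : G) :
    ∃ w : List G, (w.map ω).sum = listLength ω g ∧ w.prod = g :=
  Nat.sInf_mem (s := {N : ℕ | ∃ w : List G, (w.map ω).sum = N ∧ w.prod = g})
    ⟨_, [g], rfl, by simp⟩

theorem listLength_prod_le (ω : G → ℕ) (w : List G) : listLength ω w.prod ≤ (w.map ω).sum :=
  Nat.sInf_le ⟨w, rfl, rfl⟩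

theorem listLength_le (ω : G → ℕ) (g : G) : listLength ω g ≤ ω g := by
  simpa using listLength_prod_le ω [g]

theorem listLength_mul_le (ω : G → ℕ) (g h : G) :
    listLength ω (g * h) ≤ listLength ω g + listLength ω h := by
  obtain ⟨v, hv, hg⟩ := exists_list_sum_eq_listLength ω g
  obtain ⟨w, hw, hh⟩ := exists_list_sum_eq_listLength ω h
  simpa [hv, hw, hg, hh] using listLength_prod_le ω (v ++ w)

theorem listLength_inv_le (hω : ∀ g, ω g⁻¹ = ω g) (g : G) :
    listLength ω g⁻¹ ≤ listLength ω g := by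
  obtain ⟨w, hw, rfl⟩ := exists_list_sum_eq_listLength ω g
  have h := listLength_prod_le ω (w.map fun x => x⁻¹).reverse
  rw [← List.prod_inv_reverse, List.map_reverse, List.sum_reverse, List.map_map] at h
  rw [← hw]
  simpa [Function.comp_def, hω] using h

theorem IsLengthFun.le_listLength {ℓ : G → ℕ} (hℓ : IsLengthFun ℓ) (h : ∀ g, ℓ g ≤ ω g) (g : G) :
    ℓ g ≤ listLength ω g := by
  obtain ⟨w, hw, rfl⟩ := exists_list_sum_eq_listLength ω g
  rw [← hw]
  clear hw
  induction w with
  | nil => simp [(hℓ.1 1).2 rfl]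
  | cons a w ih =>
    have h1 := hℓ.2.2 a w.prod
    have h2 := h a
    simp only [List.prod_cons, List.map_cons, List.sum_cons]
    omega

theorem IsLengthFun.listLength {ℓ : G → ℕ} (hℓ : IsLengthFun ℓ) (h : ∀ g, ℓ g ≤ ω g)
    (hω : ∀ g, ω g⁻¹ = ω g) : IsLengthFun (listLength ω) := by
  refine ⟨fun g => ⟨fun hg => ?_, ?_⟩, fun g => ?_, listLength_mul_le ω⟩
  · rw [← hℓ.1]
    have := hℓ.le_listLength h g
    omega
  · rintro rfl
    simpa using listLength_prod_le ω []
  · refine le_antisymm (listLength_inv_le hω g) ?_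
    simpa using listLength_inv_le hω g⁻¹

theorem finite_setOf_list_prod (h1 : ∀ g, ω g = 0 → g = 1) (hω : ∀ n, {g | ω g ≤ n}.Finite)
    (n : ℕ) : {g : G | ∃ w : List G, (w.map ω).sum ≤ n ∧ w.prod = g}.Finite := by
  induction n with
  | zero =>
    refine (finite_singleton (1 : G)).subset ?_
    rintro _ ⟨w, hw, rfl⟩
    refine List.prod_eq_one fun x hx => h1 x ?_
    have := List.single_le_sum (by simp) _ (List.mem_map_of_mem (f := ω) hx)
    omega
  | succ n ih =>
    refine ((finite_singleton (1 : G)).union ((hω (n + 1)).mul ih)).subset ?_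
    rintro _ ⟨w, hw, rfl⟩
    induction w with
    | nil => simp
    | cons a w ihw =>
      simp only [List.map_cons, List.sum_cons] at hw
      rcases Nat.eq_zero_or_pos (ω a) with ha | ha
      · simpa [h1 a ha] using ihw (by omega)
      · rw [List.prod_cons]
        exact Or.inr (mul_mem_mul (show ω a ≤ n + 1 by omega) ⟨w, by omega, rfl⟩)

theorem finite_setOf_listLength_lt (h1 : ∀ g, ω g = 0 → g = 1) (hω : ∀ n, {g | ω g ≤ n}.Finite)
    (n : ℕ) : {g | listLength ω g < n}.Finite := by
  refine (finite_setOf_list_prod h1 hω n).subset fun g (hg : listLength ω g < n) => ?_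
  obtain ⟨w, hw, hwg⟩ := exists_list_sum_eq_listLength ω g
  exact ⟨w, by omega, hwg⟩

end ListLength

theorem LengthFun.dense_bounded (G : Type*) [Group G] :
    Dense {ℓ : LengthFun G | ∃ C : ℕ, ∀ g : G, ℓ.1 g ≤ C} := by
  refine LengthFun.dense_of_agree_on_finset fun ℓ F => ?_
  refine ⟨⟨_, ℓ.2.min_const (Nat.succ_pos (F.sup ℓ.1))⟩, ⟨_, fun g => min_le_right _ _⟩,
    fun g hg => ?_⟩
  exact min_eq_left ((Finset.le_sup hg).trans (Nat.le_succ _))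

theorem LengthFun.dense_proper (G : Type*) [Group G] [Countable G] :
    Dense {ℓ : LengthFun G | ∀ n : ℕ, {g : G | ℓ.1 g < n}.Finite} := by
  classical
  refine LengthFun.dense_of_agree_on_finset fun ℓ F => ?_
  obtain ⟨e, he⟩ := exists_injective_nat G
  let ω : G → ℕ := fun g => ℓ.1 g + if g ∈ F ∨ g⁻¹ ∈ F then 0 else e g + e g⁻¹
  have hle : ∀ g, ℓ.1 g ≤ ω g := fun g => Nat.le_add_right _ _
  have hinv : ∀ g, ω g⁻¹ = ω g := fun g => by
    simp only [ω, ℓ.2.2.1, inv_inv, or_comm, add_comm (e g⁻¹)]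
  have h1 : ∀ g, ω g = 0 → g = 1 := fun g hg => (ℓ.2.1 g).1 (by have := hle g; omega)
  have hfin : ∀ n, {g | ω g ≤ n}.Finite := fun n => by
    refine ((F.finite_toSet.union F.finite_toSet.inv).union
      ((finite_Iic n).preimage he.injOn)).subset fun g (hg : ω g ≤ n) => ?_
    by_cases hF : g ∈ F ∨ g⁻¹ ∈ F
    · exact Or.inl hF
    · simp only [ω, if_neg hF] at hg
      exact Or.inr (show e g ≤ n by omega)
  refine ⟨⟨_, ℓ.2.listLength hle hinv⟩, finite_setOf_listLength_lt h1 hfin, fun g hg => ?_⟩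
  refine le_antisymm ((listLength_le ω g).trans ?_) (ℓ.2.le_listLength hle g)
  simp [ω, hg]

theorem stmt10 (G : Type) [Group G] [Countable G] [Infinite G] :
    Dense {ℓ : LengthFun G | ∃ C : ℕ, ∀ g : G, ℓ.1 g ≤ C} ∧
    Dense {ℓ : LengthFun G | ∀ n : ℕ, {g : G | ℓ.1 g < n}.Finite} ∧
    Dense {ℓ : LengthFun G | ∀ C : ℕ, ∃ g : G, C < ℓ.1 g} := by
  refine ⟨LengthFun.dense_bounded G, LengthFun.dense_proper G,
    (LengthFun.dense_proper G).mono fun ℓ hℓ C => ?_⟩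
  by_contra! h
  exact infinite_univ ((hℓ (C + 1)).subset fun g _ => Nat.lt_succ_of_le (h g))
end

section
/- For any group G, every length function ℓ belonging to C = ⋂_{g ∈ G∖{1}} C(g) is a word length; more precisely, the set X_ℓ = {x ∈ G : ℓ(x) = 1} generates G and ℓ(g) equals the word length of g with respect to X_ℓ for every g ∈ G. -/
open Set Function Pointwise

theorem IsLengthFun.prod_le_length {G : Type*} [Group G] {ℓ : G → ℕ} (hℓ : IsLengthFun ℓ)
    (w : List G) (hw : ∀ x ∈ w, ℓ x ≤ 1) : ℓ w.prod ≤ w.length := by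
  induction w with
  | nil => simp [(hℓ.1 1).2 rfl]
  | cons x w ih =>
    have hx := hw x (by simp)
    have hprod := ih fun y hy => hw y (by simp [hy])
    have hmul := hℓ.2.2 x w.prod
    rw [List.prod_cons, List.length_cons]
    omega

theorem IsLengthFun.exists_geodesic {G : Type*} [Group G] {ℓ : G → ℕ} (hℓ : IsLengthFun ℓ)
    (hC : ∀ g : G, g ≠ 1 → ∃ h : G, ℓ h = ℓ g - 1 ∧ ℓ (h⁻¹ * g) = 1) (g : G) :
    ∃ w : List G, w.length = ℓ g ∧ (∀ x ∈ w, ℓ x = 1) ∧ w.prod = g := by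
  induction hn : ℓ g generalizing g with
  | zero => exact ⟨[], rfl, by simp, by simp [(hℓ.1 g).1 hn]⟩
  | succ n ih =>
    have hg : g ≠ 1 := fun h => by simp [(hℓ.1 g).2 h] at hn
    obtain ⟨h, hh, hx⟩ := hC g hg
    obtain ⟨w, hlen, hw, hprod⟩ := ih h (by omega)
    refine ⟨w ++ [h⁻¹ * g], by simp [hlen], fun x hmem => ?_, by simp [hprod]⟩
    rcases List.mem_append.1 hmem with hmem | hmem
    · exact hw x hmem
    · rwa [List.mem_singleton.1 hmem]

theorem stmt12 (G : Type*) [Group G] (ℓ : LengthFun G)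
    (hC : ∀ g : G, g ≠ 1 → ∃ h : G, ℓ.1 h = ℓ.1 g - 1 ∧ ℓ.1 (h⁻¹ * g) = 1) :
    Subgroup.closure {x : G | ℓ.1 x = 1} = ⊤ ∧
      ∀ g : G, ℓ.1 g = wordLength {x : G | ℓ.1 x = 1} g := by
  refine ⟨(Subgroup.eq_top_iff' _).2 fun g => ?_, fun g => ?_⟩
  · obtain ⟨w, -, hw, rfl⟩ := ℓ.2.exists_geodesic hC g
    exact Subgroup.list_prod_mem _ fun x hx => Subgroup.subset_closure (hw x hx)
  · obtain ⟨w, hlen, hw, hprod⟩ := ℓ.2.exists_geodesic hC g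
    have hmem : ∃ v : List G, v.length = ℓ.1 g ∧
        (∀ x ∈ v, x ∈ {x : G | ℓ.1 x = 1} ∨ x⁻¹ ∈ {x : G | ℓ.1 x = 1}) ∧ v.prod = g :=
      ⟨w, hlen, fun x hx => Or.inl (hw x hx), hprod⟩
    refine le_antisymm (le_csInf ⟨_, hmem⟩ ?_) (Nat.sInf_le hmem)
    rintro _ ⟨v, rfl, hv, rfl⟩
    refine ℓ.2.prod_le_length v fun x hx => ?_
    rcases hv x hx with h | h
    · exact le_of_eq h
    · exact ((ℓ.2.2.1 x).symm.trans h).le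
end

section
/- Let G be a countably infinite group. If G contains a nontrivial element whose conjugacy class is finite, then the conjugacy action of G on L(G) is not topologically transitive. -/
open Set Function Pointwise

/-- Every positive constant is the nontrivial value of a length function. -/
theorem isLengthFun_ite_const {G : Type*} [Group G] [DecidableEq G] {c : ℕ} (hc : c ≠ 0) :
    IsLengthFun fun x : G => if x = 1 then 0 else c := by
  refine ⟨fun x => by simp [hc], fun x => by simp, fun x y => ?_⟩
  by_cases hx : x = 1
  · simp [hx]
  · simp only [hx, if_false]
    split_ifs <;> omega

/-- Evaluation at a group element is continuous on the space of length functions. -/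
theorem continuous_lengthFun_eval {G : Type*} [Group G] (x : G) :
    Continuous fun ℓ : LengthFun G => ℓ.1 x :=
  (continuous_apply x).comp continuous_subtype_val

theorem stmt15 (G : Type) [Group G] [Countable G] [Infinite G]
    (h : ∃ g : G, g ≠ 1 ∧ {h : G | IsConj g h}.Finite) :
    ¬ConjTopTransitive G := by
  classical
  obtain ⟨g, hg, hfin⟩ := h
  intro htrans
  let U : Set (LengthFun G) := ⋂ x ∈ {x : G | IsConj g x}, {ℓ | ℓ.1 x = 1}
  let V : Set (LengthFun G) := {ℓ | ℓ.1 g = 2}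
  have hU : IsOpen U := hfin.isOpen_biInter fun x _ =>
    (isOpen_discrete {1}).preimage (continuous_lengthFun_eval x)
  have hV : IsOpen V := (isOpen_discrete {2}).preimage (continuous_lengthFun_eval g)
  have hUne : U.Nonempty := by
    refine ⟨⟨_, isLengthFun_ite_const one_ne_zero⟩, mem_iInter₂.2 fun x hx => if_neg ?_⟩
    rintro rfl
    exact hg (isConj_one_left.1 hx)
  have hVne : V.Nonempty := ⟨⟨_, isLengthFun_ite_const two_ne_zero⟩, if_neg hg⟩
  obtain ⟨k, _, ⟨ℓ, hℓ, rfl⟩, hk⟩ := htrans U V hU hV hUne hVne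
  have hconj : IsConj g (k⁻¹ * g * k) := isConj_iff.2 ⟨k⁻¹, by simp⟩
  have h1 : ℓ.1 (k⁻¹ * g * k) = 1 := mem_iInter₂.1 hℓ _ hconj
  have h2 : ℓ.1 (k⁻¹ * g * k) = 2 := hk
  omega
end

section
/- Let G be an ICC group. For any finite subsets A, B of G∖{1}, there exists g ∈ G such that A^g ∩ B = ∅, where A^g = {g⁻¹ag : a ∈ A}. -/
open Set Function Pointwise

/-- An element whose centralizer has finite index has finitely many conjugates. -/
theorem finite_setOf_isConj_of_finiteIndex_centralizer {G : Type*} [Group G] (b : G)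
    (hb : (Subgroup.centralizer ({b} : Set G)).FiniteIndex) : {h : G | IsConj b h}.Finite := by
  have : Finite (G ⧸ Subgroup.centralizer ({b} : Set G)) :=
    Subgroup.finite_quotient_of_finiteIndex
  refine (finite_range fun q : G ⧸ Subgroup.centralizer ({b} : Set G) =>
    q.out * b * q.out⁻¹).subset ?_
  intro h hh
  obtain ⟨c, rfl⟩ := isConj_iff.1 hh
  obtain ⟨k, hk⟩ := QuotientGroup.mk_out_eq_mul (Subgroup.centralizer ({b} : Set G)) c
  have hkb : (k : G) * b = b * k := Subgroup.mem_centralizer_singleton_iff.1 k.2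
  refine ⟨(c : G ⧸ Subgroup.centralizer ({b} : Set G)), ?_⟩
  simp only [hk, mul_inv_rev, mul_assoc, mul_right_inj]
  rw [← mul_assoc (k : G) b, hkb]
  simp [mul_assoc]

/-- The elements conjugating `a` to `b` lie in a single left coset of the centralizer of `b`. -/
theorem exists_setOf_conj_eq_subset_smul_centralizer {G : Type*} [Group G] (a b : G) :
    ∃ c : G, {g : G | g⁻¹ * a * g = b} ⊆ c • (Subgroup.centralizer ({b} : Set G) : Set G) := by
  rcases {g : G | g⁻¹ * a * g = b}.eq_empty_or_nonempty with h | ⟨c, hc⟩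
  · exact ⟨1, h ▸ empty_subset _⟩
  · refine ⟨c, fun g hg => ?_⟩
    rw [mem_smul_set_iff_inv_smul_mem, smul_eq_mul, SetLike.mem_coe,
      Subgroup.mem_centralizer_singleton_iff]
    have hc' : a = c * b * c⁻¹ := by rw [← show c⁻¹ * a * c = b from hc]; group
    have hg' : a = g * b * g⁻¹ := by rw [← show g⁻¹ * a * g = b from hg]; group
    calc c⁻¹ * g * b = c⁻¹ * (g * b * g⁻¹) * g := by group
      _ = c⁻¹ * (c * b * c⁻¹) * g := by rw [← hg', ← hc']
      _ = b * (c⁻¹ * g) := by group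

theorem stmt16 (G : Type*) [Group G]
    (hICC : ∀ g : G, g ≠ 1 → {h : G | IsConj g h}.Infinite)
    (A B : Set G) (hA : A.Finite) (hB : B.Finite)
    (hA1 : (1 : G) ∉ A) (hB1 : (1 : G) ∉ B) :
    ∃ g : G, ((fun a => g⁻¹ * a * g) '' A) ∩ B = ∅ := by
  by_contra! h
  choose c hc using exists_setOf_conj_eq_subset_smul_centralizer (G := G)
  have hcovers : ⋃ p ∈ (hA.prod hB).toFinset,
      c p.1 p.2 • (Subgroup.centralizer ({p.2} : Set G) : Set G) = univ := by
    refine eq_univ_of_forall fun g => ?_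
    obtain ⟨b, ⟨a, ha, hab⟩, hb⟩ := h g
    exact mem_biUnion (x := (a, b)) (by simp [ha, hb]) (hc a b hab)
  obtain ⟨p, hp, hfin⟩ := Subgroup.exists_finiteIndex_of_leftCoset_cover hcovers
  have hpB : p.2 ∈ B := ((hA.prod hB).mem_toFinset.1 hp).2
  exact hICC p.2 (ne_of_mem_of_not_mem hpB hB1)
    (finite_setOf_isConj_of_finiteIndex_centralizer p.2 hfin)
end

section
/- Let G be a countably infinite group. If the conjugacy action of G on L(G) is topologically transitive, then for every finite-index normal subgroup H of G, the commutator subgroup [H,H] is nontrivial and ICC. -/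
open Set Function Pointwise

section LengthFunctions

variable {G : Type*} [Group G]

/-- A symmetric function vanishing exactly at `1`, with all other values in `[m, 2m]`, is a length
function. -/
theorem isLengthFun_of_le_two_mul {ℓ : G → ℕ} {m : ℕ} (hm : 0 < m) (h1 : ℓ 1 = 0)
    (hinv : ∀ g, ℓ g⁻¹ = ℓ g) (hlow : ∀ g, g ≠ 1 → m ≤ ℓ g) (hup : ∀ g, ℓ g ≤ 2 * m) :
    IsLengthFun ℓ := by
  refine ⟨fun g => ⟨fun h => ?_, fun h => h ▸ h1⟩, hinv, fun g h => ?_⟩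
  · by_contra hg
    have := hlow g hg
    omega
  · by_cases hg : g = 1
    · simp [hg]
    by_cases hh : h = 1
    · simp [hh]
    have := hlow g hg
    have := hlow h hh
    have := hup (g * h)
    omega

open Classical in
theorem isLengthFun_const {m : ℕ} (hm : 0 < m) :
    IsLengthFun (fun x : G => if x = 1 then 0 else m) := by
  refine isLengthFun_of_le_two_mul hm (by simp) (by simp) (fun g hg => by simp [hg]) fun g => ?_
  split_ifs <;> omega

open Classical in
theorem isLengthFun_single {m : ℕ} (hm : 0 < m) (a : G) :
    IsLengthFun
      (fun x : G => if x = 1 then 0 else if x = a ∨ x = a⁻¹ then m else 2 * m) := by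
  refine isLengthFun_of_le_two_mul hm (by simp) (fun g => ?_) (fun g hg => ?_) fun g => ?_
  · have h : (g⁻¹ = a ∨ g⁻¹ = a⁻¹) ↔ (g = a ∨ g = a⁻¹) := by
      rw [inv_inj, inv_eq_iff_eq_inv, or_comm]
    simp only [inv_eq_one, h]
  all_goals
    split_ifs <;> first | omega | contradiction

/-- Prescribing the values of a length function on a finite set is an open condition. -/
theorem isOpen_setOf_forall_eq {S : Set G} (hS : S.Finite) (n : ℕ) :
    IsOpen {ℓ : LengthFun G | ∀ x ∈ S, ℓ.1 x = n} := by
  have h : {ℓ : LengthFun G | ∀ x ∈ S, ℓ.1 x = n} = ⋂ x ∈ S, {ℓ : LengthFun G | ℓ.1 x = n} := by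
    ext; simp
  rw [h]
  exact hS.isOpen_biInter fun x _ =>
    (isOpen_discrete ({n} : Set ℕ)).preimage
      (show Continuous fun ℓ : LengthFun G => ℓ.1 x from
        (continuous_apply x).comp continuous_subtype_val)

/-- Conjugacy classes of nontrivial elements are infinite if the action is transitive. -/
theorem ConjTopTransitive.infinite_conj (hTT : ConjTopTransitive G) {a : G} (ha : a ≠ 1) :
    {x : G | ∃ c : G, c * a * c⁻¹ = x}.Infinite := by
  classical
  intro hfin
  have hne : ∀ x ∈ {x : G | ∃ c : G, c * a * c⁻¹ = x}, x ≠ 1 := by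
    rintro _ ⟨c, rfl⟩ h
    exact ha (conj_eq_one_iff.mp h)
  obtain ⟨g, ℓ', ⟨ℓ, hU, rfl⟩, hV⟩ :=
    hTT _ _ (isOpen_setOf_forall_eq hfin 1) (isOpen_setOf_forall_eq hfin 2)
      ⟨⟨_, isLengthFun_const one_pos⟩, fun x hx => if_neg (hne x hx)⟩
      ⟨⟨_, isLengthFun_const two_pos⟩, fun x hx => if_neg (hne x hx)⟩
  have h1 := hU (g⁻¹ * a * g) ⟨g⁻¹, by simp⟩
  have h2 : ℓ.1 (g⁻¹ * a * g) = 2 := hV a ⟨1, by simp⟩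
  omega

/-- Conjugacy classes under a finite-index subgroup are infinite if the action is transitive. -/
theorem ConjTopTransitive.infinite_conj_of_finiteIndex (hTT : ConjTopTransitive G)
    (H : Subgroup G) [H.FiniteIndex] {a : G} (ha : a ≠ 1) :
    {x : G | ∃ c ∈ H, c * a * c⁻¹ = x}.Infinite := by
  intro hfin
  refine hTT.infinite_conj ha (((Set.finite_univ (α := G ⧸ H)).image2
    (fun q x => q.out * x * q.out⁻¹) hfin).subset ?_)
  rintro _ ⟨g, rfl⟩
  refine ⟨(g : G ⧸ H), mem_univ _, _, ⟨(g : G ⧸ H).out⁻¹ * g, ?_, rfl⟩, by group⟩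
  exact QuotientGroup.eq.mp (QuotientGroup.out_eq' _)

theorem ConjTopTransitive.infinite_conj_commutator (hTT : ConjTopTransitive G)
    (H : Subgroup G) [H.Normal] [H.FiniteIndex] {a : G} (ha : a ≠ 1) :
    {x : G | ∃ c ∈ ⁅H, H⁆, c⁻¹ * a * c = x}.Infinite := by
  classical
  intro hfin
  set C : Set G := {x : G | ∃ c ∈ ⁅H, H⁆, c⁻¹ * a * c = x}
  obtain ⟨_, ⟨t, htH, rfl⟩, htC⟩ :=
    (hTT.infinite_conj_of_finiteIndex H ha).exists_notMem_finite (hfin.union hfin.inv)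
  have hC1 : ∀ x ∈ C, x ≠ 1 := by
    rintro _ ⟨c, -, rfl⟩ h
    exact ha (by simpa [mul_assoc, inv_mul_eq_one] using h)
  have hCa : ∀ x ∈ C, t * x * t⁻¹ ≠ a ∧ t * x * t⁻¹ ≠ a⁻¹ := by
    rintro _ ⟨c, hc, rfl⟩
    have hc' : t * c⁻¹ * t⁻¹ ∈ ⁅H, H⁆ :=
      (inferInstance : (⁅H, H⁆).Normal).conj_mem _ (inv_mem hc) t
    refine ⟨fun h => htC (Or.inl ⟨_, hc', ?_⟩), fun h => htC (Or.inr ⟨_, hc', ?_⟩)⟩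
    · nth_rewrite 1 [← h]; group
    · nth_rewrite 1 [inv_eq_iff_eq_inv.mp h.symm]; group
  have hUopen := (isOpen_setOf_forall_eq (Set.finite_singleton a) 3).inter
    (isOpen_setOf_forall_eq (hfin.image fun x => t * x * t⁻¹) 6)
  have hVopen := isOpen_setOf_forall_eq
    (Set.finite_range fun q : G ⧸ H => q.out * t * q.out⁻¹) 1
  have ht1 : t ≠ 1 := by
    rintro rfl
    exact htC (Or.inl ⟨1, one_mem _, by simp⟩)
  obtain ⟨g, ℓ', ⟨ℓ, ⟨hUa, hUC⟩, rfl⟩, hV⟩ := hTT _ _ hUopen hVopen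
    ⟨⟨_, isLengthFun_single (m := 3) (by norm_num) a⟩, by simp [ha], by
      rintro _ ⟨x, hx, rfl⟩
      simp [hC1 x hx, hCa x hx]⟩
    ⟨⟨_, isLengthFun_const one_pos⟩, by
      rintro _ ⟨q, rfl⟩
      simp [ht1]⟩
  set r : G := (g : G ⧸ H).out
  have hr : r⁻¹ * g ∈ H := QuotientGroup.eq.mp (QuotientGroup.out_eq' _)
  have h1 : ℓ.1 (g⁻¹ * (r * t * r⁻¹) * g) = 1 := hV _ ⟨(g : G ⧸ H), rfl⟩
  set s : G := g⁻¹ * (r * t * r⁻¹) * g with hs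
  have hk : t⁻¹ * s ∈ ⁅H, H⁆ := by
    have := Subgroup.commutator_mem_commutator (inv_mem htH) (inv_mem hr)
    rw [commutatorElement_def] at this
    convert this using 1
    rw [hs]; group
  have h6 : ℓ.1 (s * a * s⁻¹) = 6 :=
    hUC _ ⟨_, ⟨_, inv_mem hk, rfl⟩, by simp [mul_assoc]⟩
  have h3 : ℓ.1 a = 3 := hUa a rfl
  have hinv := ℓ.2.2.1 s
  have hle := ℓ.2.2.2 (s * a) s⁻¹
  have hle' := ℓ.2.2.2 s a
  omega

end LengthFunctions

theorem stmt17 (G : Type) [Group G] [Countable G] [Infinite G]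
    (hTT : ConjTopTransitive G) (H : Subgroup G) (hN : H.Normal) (hFI : H.FiniteIndex) :
    ⁅H, H⁆ ≠ (⊥ : Subgroup G) ∧
      ∀ g ∈ ⁅H, H⁆, g ≠ 1 → {x : G | ∃ c ∈ ⁅H, H⁆, c⁻¹ * g * c = x}.Infinite := by
  refine ⟨fun hbot => ?_, fun g _ hg => hTT.infinite_conj_commutator H hg⟩
  obtain ⟨a, ha⟩ := exists_ne (1 : G)
  refine hTT.infinite_conj_commutator H ha ((Set.finite_singleton a).subset ?_)
  rintro _ ⟨c, hc, rfl⟩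
  rw [hbot, Subgroup.mem_bot] at hc
  simp [hc]
end

section
/- Let G be a countably infinite group which is either (a) solvable and linear over a field (i.e., isomorphic to a subgroup of GLₙ(K) for some n and some field K), or (b) nilpotent-by-abelian (i.e., has a nilpotent normal subgroup with abelian quotient). Then the conjugacy action of G on L(G) is not topologically transitive. -/
open Set Function Pointwise

open scoped commutatorElement

lemma isLengthFun_of_bounds {G : Type*} [Group G] (M : ℕ) (ℓ : G → ℕ) (h1 : ℓ 1 = 0)
    (hinv : ∀ g, ℓ g⁻¹ = ℓ g) (hM : ∀ g, g ≠ 1 → M + 1 ≤ ℓ g ∧ ℓ g ≤ 2 * (M + 1)) :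
    IsLengthFun ℓ := by
  refine ⟨fun g => ⟨fun h => ?_, fun h => h ▸ h1⟩, hinv, fun g h => ?_⟩
  · by_contra hg
    have := (hM g hg).1
    omega
  · by_cases hg : g = 1
    · simp [hg]
    by_cases hh : h = 1
    · simp [hh]
    by_cases hgh : g * h = 1
    · simp [hgh, h1]
    have := hM g hg
    have := hM h hh
    have := hM _ hgh
    omega

lemma isOpen_setOf_lengthFun_eq {G : Type*} [Group G] (x : G) (n : ℕ) :
    IsOpen {ℓ : LengthFun G | ℓ.1 x = n} := by
  have hc : Continuous fun ℓ : LengthFun G => ℓ.1 x :=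
    (continuous_apply x).comp continuous_subtype_val
  exact (isOpen_discrete {n}).preimage hc

/-- A nontrivial element centralized by the derived subgroup of a finite index subgroup
obstructs topological transitivity. -/
lemma not_conjTopTransitive_of_commutator_le_centralizer {G : Type*} [Group G] (H : Subgroup G)
    [H.FiniteIndex] (a : G) (ha : a ≠ 1) (hHa : ⁅H, H⁆ ≤ Subgroup.centralizer {a}) :
    ¬ConjTopTransitive G := by
  classical
  intro htr
  have hopen (t : G) (n : ℕ) :
      IsOpen {ℓ : LengthFun G | ∀ q : G ⧸ H, ℓ.1 (q.out * t * q.out⁻¹) = n} := by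
    rw [Set.ofPred_forall]
    exact isOpen_iInter_of_finite fun q => isOpen_setOf_lengthFun_eq _ _
  have hrep (g : G) : ∃ q : G ⧸ H, ∃ h ∈ H, g = q.out * h :=
    ⟨(g : G ⧸ H), (g : G ⧸ H).out⁻¹ * g, QuotientGroup.eq.1 (QuotientGroup.out_eq' _), by group⟩
  have hconj (q h t : G) : (q * h)⁻¹ * (q * t * q⁻¹) * (q * h) = h⁻¹ * t * h := by group
  have hconst (n : ℕ) : IsLengthFun fun x : G => if x = 1 then 0 else n + 1 :=
    isLengthFun_of_bounds n _ (by simp) (fun g => by simp) fun g hg => by simp only [hg, if_false]; omega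
  by_cases hex : ∃ t ∈ H, t * a * t⁻¹ ≠ a ∧ t * a * t⁻¹ ≠ a⁻¹
  · obtain ⟨t, htH, ht1, ht2⟩ := hex
    have ht : t ≠ 1 := by rintro rfl; simp at ht1
    obtain ⟨g, -, ⟨ℓ, hℓ, rfl⟩, hV⟩ := htr {ℓ | ℓ.1 a = 3 ∧ ℓ.1 (t * a * t⁻¹) = 6}
      {ℓ | ∀ q : G ⧸ H, ℓ.1 (q.out * t * q.out⁻¹) = 1}
      ((isOpen_setOf_lengthFun_eq _ _).inter (isOpen_setOf_lengthFun_eq _ _)) (hopen t 1)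
      ⟨⟨fun x => if x = 1 then 0 else if x = a ∨ x = a⁻¹ then 3 else 6,
        isLengthFun_of_bounds 2 _ (by simp)
          (fun g => by simp [inv_eq_iff_eq_inv, or_comm])
          (fun g hg => by simp only [hg, if_false]; split_ifs <;> simp)⟩,
        by simp [ha], by simp [ha, ht1, ht2]⟩
      ⟨⟨_, hconst 0⟩, fun q => by simp [ht]⟩
    obtain ⟨q, h, hh, rfl⟩ := hrep g
    have h1 : ℓ.1 (h⁻¹ * t * h) = 1 := by
      have := hV q
      dsimp only [conjLF, Set.mem_ofPred_eq] at this
      rwa [hconj] at this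
    have hc : ⁅t⁻¹, h⁻¹⁆ ∈ Subgroup.centralizer {a} :=
      hHa (Subgroup.commutator_mem_commutator (H.inv_mem htH) (H.inv_mem hh))
    have hca := Subgroup.mem_centralizer_singleton_iff.1 hc
    have h2 : t * a * t⁻¹ = (h⁻¹ * t * h) * a * (h⁻¹ * t * h)⁻¹ := by
      have e : h⁻¹ * t * h = t * ⁅t⁻¹, h⁻¹⁆ := by rw [commutatorElement_def]; group
      rw [e, mul_inv_rev, mul_assoc t ⁅t⁻¹, h⁻¹⁆ a, hca]
      group
    have h3 := ℓ.2.2.2 (h⁻¹ * t * h * a) (h⁻¹ * t * h)⁻¹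
    have h4 := ℓ.2.2.2 (h⁻¹ * t * h) a
    rw [← h2, ℓ.2.2.1] at h3
    have := hℓ.1
    have := hℓ.2
    omega
  · push Not at hex
    obtain ⟨g, -, ⟨ℓ, hℓ, rfl⟩, hV⟩ := htr {ℓ | ℓ.1 a = 1}
      {ℓ | ∀ q : G ⧸ H, ℓ.1 (q.out * a * q.out⁻¹) = 2}
      (isOpen_setOf_lengthFun_eq _ _) (hopen a 2)
      ⟨⟨_, hconst 0⟩, by simp [ha]⟩ ⟨⟨_, hconst 1⟩, fun q => by simp [ha]⟩
    obtain ⟨q, h, hh, rfl⟩ := hrep g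
    have h1 : ℓ.1 (h⁻¹ * a * h) = 2 := by
      have := hV q
      dsimp only [conjLF, Set.mem_ofPred_eq] at this
      rwa [hconj] at this
    have h2 := hex h⁻¹ (H.inv_mem hh)
    rw [inv_inv] at h2
    change ℓ.1 a = 1 at hℓ
    by_cases h3 : h⁻¹ * a * h = a
    · rw [h3] at h1; omega
    · rw [h2 h3, ℓ.2.2.1] at h1; omega

section Linear

variable {K V : Type*} [Field K] [AddCommGroup V] [Module K V] [FiniteDimensional K V]

lemma finite_setOf_weight {ι : Type*} (f : ι → Module.End K V) (hf : ∀ i j, Commute (f i) (f j)) :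
    {χ : ι → K | ∃ v ≠ 0, ∀ i, f i v = χ i • v}.Finite := by
  have hind := Module.End.independent_iInf_maxGenEigenspace_of_forall_mapsTo f
    fun i j φ => Module.End.mapsTo_maxGenEigenspace_of_comm (hf j i) φ
  refine (WellFoundedGT.finite_ne_bot_of_iSupIndep hind).subset ?_
  rintro χ ⟨v, hv, h⟩ hbot
  refine hv ((Submodule.mem_bot K).1 (hbot ▸ (Submodule.mem_iInf _).2 fun i => ?_))
  exact Module.End.mem_maxGenEigenspace _ _ _ |>.2 ⟨1, by simp [h i]⟩

lemma exists_weight [IsAlgClosed K] [Nontrivial V] {ι : Type*} (f : ι → Module.End K V)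
    (hf : ∀ i j, Commute (f i) (f j)) : ∃ χ : ι → K, ∃ v ≠ 0, ∀ i, f i v = χ i • v := by
  obtain ⟨W, ⟨hW0, hWf⟩, hmin⟩ := wellFounded_lt.has_min
    {W : Submodule K V | W ≠ ⊥ ∧ ∀ i, ∀ v ∈ W, f i v ∈ W} ⟨⊤, top_ne_bot, by simp⟩
  have : Nontrivial W := Submodule.nontrivial_iff_ne_bot.2 hW0
  have hscal (i : ι) : ∃ c : K, ∀ v ∈ W, f i v = c • v := by
    obtain ⟨c, hc⟩ := Module.End.exists_eigenvalue ((f i).restrict (hWf i))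
    obtain ⟨w, hw⟩ := hc.exists_hasEigenvector
    have hw' : f i w = c • (w : V) := congrArg Subtype.val hw.apply_eq_smul
    refine ⟨c, fun v hv => ?_⟩
    have heq : W ⊓ (f i).eigenspace c = W := by
      by_contra hne
      refine hmin (W ⊓ (f i).eigenspace c) ⟨?_, fun j v hv => ⟨hWf j v hv.1, ?_⟩⟩
        (lt_of_le_of_ne inf_le_left hne)
      · exact (Submodule.ne_bot_iff _).2
          ⟨w, ⟨w.2, Module.End.mem_eigenspace_iff.2 hw'⟩, by simpa using hw.2⟩
      · have h1 := Module.End.mem_eigenspace_iff.1 hv.2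
        refine Module.End.mem_eigenspace_iff.2 ?_
        rw [← Module.End.mul_apply, (hf i j).eq, Module.End.mul_apply, h1, map_smul]
    rw [← heq] at hv
    exact Module.End.mem_eigenspace_iff.1 hv.2
  choose χ hχ using hscal
  obtain ⟨v, hv, hv0⟩ := (Submodule.ne_bot_iff _).1 hW0
  exact ⟨χ, v, hv0, fun i => hχ i v hv⟩

end Linear

lemma Subgroup.finiteIndex_of_finite_range {Γ X : Type*} [Group Γ] (D : Subgroup Γ) (F : Γ → X)
    (hF : (Set.range F).Finite) (h : ∀ g k, F g = F k → g⁻¹ * k ∈ D) : D.FiniteIndex := by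
  have := hF.to_subtype
  have : Finite (Γ ⧸ D) := by
    refine Finite.of_injective (fun q : Γ ⧸ D => (⟨F q.out, q.out, rfl⟩ : Set.range F)) ?_
    intro q r hqr
    have := QuotientGroup.eq.2 (h _ _ (Subtype.ext_iff.1 hqr))
    rwa [QuotientGroup.out_eq', QuotientGroup.out_eq'] at this
  exact Subgroup.finiteIndex_of_finite_quotient

section StronglyIrreducible

variable {K S Γ : Type*} [Field K] [AddCommGroup S] [Module K S] [Group Γ]

/-- A representation all of whose restrictions to finite index subgroups are irreducible. -/
def StronglyIrreducible (σ : Representation K Γ S) : Prop :=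
  ∀ D : Subgroup Γ, D.FiniteIndex → ∀ W : Submodule K S, (∀ g ∈ D, ∀ v ∈ W, σ g v ∈ W) →
    W = ⊥ ∨ W = ⊤

variable [IsAlgClosed K] [FiniteDimensional K S] [Nontrivial S] {σ : Representation K Γ S}

namespace StronglyIrreducible

lemma eq_smul_one_of_commute (hσ : StronglyIrreducible σ) (D : Subgroup Γ) [hD : D.FiniteIndex]
    (T : Module.End K S) (hT : ∀ g ∈ D, Commute (σ g) T) : ∃ c : K, T = c • 1 := by
  obtain ⟨c, hc⟩ := Module.End.exists_eigenvalue T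
  refine ⟨c, ?_⟩
  have htop := (hσ D hD (T.eigenspace c) fun g hg v hv => ?_).resolve_left hc
  · ext v
    exact Module.End.mem_eigenspace_iff.1 (htop ▸ Submodule.mem_top : v ∈ T.eigenspace c)
  · rw [Module.End.mem_eigenspace_iff] at hv ⊢
    rw [← Module.End.mul_apply, ← (hT g hg).eq, Module.End.mul_apply, hv, map_smul]

lemma eq_smul_one_of_mem_of_forall_commute (hσ : StronglyIrreducible σ) (C : Subgroup Γ)
    [C.Normal] (hC : ∀ x ∈ C, ∀ y ∈ C, Commute (σ x) (σ y)) {x : Γ} (hx : x ∈ C) :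
    ∃ c : K, σ x = c • 1 := by
  have hf : ∀ x y : C, Commute (σ x) (σ y) := fun x y => hC x x.2 y y.2
  obtain ⟨χ, v, hv, hχ⟩ := exists_weight (fun x : C => σ x) hf
  have hw (g : Γ) (w : S) (hw : ∀ x : C, σ x w = χ x • w) (x : C) :
      σ x (σ g w) = χ (MulAut.conjNormal g⁻¹ x) • σ g w := by
    have h1 := hw (MulAut.conjNormal g⁻¹ x)
    rw [← map_smul, ← h1, ← Module.End.mul_apply, ← Module.End.mul_apply, ← map_mul, ← map_mul,
      MulAut.conjNormal_apply]
    congr 2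
    group
  let D : Subgroup Γ :=
    { carrier := {g | ∀ x : C, χ (MulAut.conjNormal g⁻¹ x) = χ x}
      one_mem' := fun x => by rw [inv_one, map_one, MulAut.one_apply]
      mul_mem' := fun {a b} ha hb x => by
        rw [mul_inv_rev, map_mul, MulAut.mul_apply, hb, ha]
      inv_mem' := fun {a} ha x => by
        rw [← ha, ← MulAut.mul_apply, ← map_mul]; simp }
  have hD : D.FiniteIndex := by
    refine D.finiteIndex_of_finite_range (fun g (x : C) => χ (MulAut.conjNormal g⁻¹ x))
      ((finite_setOf_weight _ hf).subset ?_) fun g k hgk x => ?_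
    · rintro _ ⟨g, rfl⟩
      refine ⟨σ g v, fun h0 => hv ?_, hw g v hχ⟩
      rw [← σ.inv_self_apply g v, h0, map_zero]
    · have := congrFun hgk (MulAut.conjNormal g x)
      simp only [← MulAut.mul_apply, ← map_mul] at this
      simpa using this.symm
  have htop := (hσ D hD (⨅ x : C, Module.End.eigenspace (σ x) (χ x))
    fun g hg w hw' => ?_).resolve_left ?_
  · refine ⟨χ ⟨x, hx⟩, ?_⟩
    ext w
    have hm : w ∈ ⨅ x : C, Module.End.eigenspace (σ x) (χ x) := htop ▸ Submodule.mem_top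
    exact Module.End.mem_eigenspace_iff.1 ((Submodule.mem_iInf _).1 hm ⟨x, hx⟩)
  · simp only [Submodule.mem_iInf, Module.End.mem_eigenspace_iff] at hw' ⊢
    intro x
    rw [hw g w hw' x, hg x]
  · refine (Submodule.ne_bot_iff _).2 ⟨v, ?_, hv⟩
    simpa only [Submodule.mem_iInf, Module.End.mem_eigenspace_iff] using hχ

end StronglyIrreducible

end StronglyIrreducible

lemma finite_setOf_smul_det_eq {K S : Type*} [Field K] [AddCommGroup S] [Module K S]
    [FiniteDimensional K S] [Nontrivial S] (T : Module.End K S) (d : K) (hT : LinearMap.det T ≠ 0) :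
    {T' : Module.End K S | (∃ c : K, T' = c • T) ∧ LinearMap.det T' = d}.Finite := by
  have hn : 0 < Module.finrank K S := Module.finrank_pos
  refine ((Polynomial.nthRoots (Module.finrank K S)
    (d / LinearMap.det T)).finite_toSet.image (· • T)).subset ?_
  rintro _ ⟨⟨c, rfl⟩, hd⟩
  rw [LinearMap.det_smul] at hd
  exact ⟨c, (Polynomial.mem_nthRoots hn).2 (by rw [← hd, mul_div_cancel_right₀ _ hT]), rfl⟩

namespace Representation

variable {K S Γ : Type*} [Field K] [AddCommGroup S] [Module K S] [Group Γ]

lemma det_ne_zero (σ : Representation K Γ S) (g : Γ) :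
    LinearMap.det (σ g) ≠ 0 := by
  have h : LinearMap.det (σ g) * LinearMap.det (σ g⁻¹) = 1 := by
    rw [← map_mul, ← map_mul, mul_inv_cancel, map_one, map_one]
  exact left_ne_zero_of_mul_eq_one h

lemma apply_mul_cancel (σ : Representation K Γ S) (g : Γ) : σ g * σ g⁻¹ = 1 := by
  rw [← map_mul, mul_inv_cancel, map_one]

end Representation

section StronglyIrreducible

variable {K S Γ : Type*} [Field K] [AddCommGroup S] [Module K S] [Group Γ]
  [IsAlgClosed K] [FiniteDimensional K S] [Nontrivial S] {σ : Representation K Γ S}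

namespace StronglyIrreducible

lemma eq_smul_one_of_commutator (hσ : StronglyIrreducible σ) (B : Subgroup Γ) [B.Normal]
    (hB : ∀ x ∈ ⁅B, B⁆, ∃ c : K, σ x = c • 1) {b : Γ} (hb : b ∈ B) : ∃ c : K, σ b = c • 1 := by
  have hswap (x y : Γ) (hx : x ∈ B) (hy : y ∈ B) :
      ∃ c : K, σ x * σ y = c • (σ y * σ x) := by
    obtain ⟨c, hc⟩ := hB _ (Subgroup.commutator_mem_commutator hx hy)
    refine ⟨c, ?_⟩
    have h : x * y = ⁅x, y⁆ * (y * x) := by rw [commutatorElement_def]; group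
    rw [← map_mul, h, map_mul, hc, smul_mul_assoc, one_mul, map_mul]
  let C : Subgroup Γ :=
    { carrier := {x | x ∈ B ∧ ∀ y ∈ B, Commute (σ x) (σ y)}
      one_mem' := ⟨B.one_mem, fun y _ => by rw [map_one]; exact Commute.one_left _⟩
      mul_mem' := fun {x y} hx hy => ⟨B.mul_mem hx.1 hy.1, fun z hz => by
        rw [map_mul]; exact (hx.2 z hz).mul_left (hy.2 z hz)⟩
      inv_mem' := fun {x} hx => ⟨B.inv_mem hx.1, fun y hy => by
        have h := (hx.2 y hy).eq
        calc σ x⁻¹ * σ y = σ x⁻¹ * (σ y * σ x) * σ x⁻¹ := by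
              rw [mul_assoc, mul_assoc, σ.apply_mul_cancel, mul_one]
          _ = σ y * σ x⁻¹ := by
              rw [← h, ← mul_assoc, ← map_mul, inv_mul_cancel, map_one, one_mul]⟩ }
  have hCn : C.Normal := by
    refine ⟨fun x hx g => ⟨‹B.Normal›.conj_mem x hx.1 g, fun y hy => ?_⟩⟩
    have h := hx.2 (g⁻¹ * y * g) (by simpa using ‹B.Normal›.conj_mem y hy g⁻¹)
    have e : y = g * (g⁻¹ * y * g) * g⁻¹ := by group
    have key : σ (g * (x * (g⁻¹ * y * g)) * g⁻¹) = σ (g * ((g⁻¹ * y * g) * x) * g⁻¹) := by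
      rw [map_mul, map_mul, map_mul σ x, h.eq, ← map_mul σ _ x, ← map_mul, ← map_mul]
    rw [Commute, SemiconjBy, ← map_mul, ← map_mul]
    convert key using 2 <;> group
  have hC {x : Γ} (hx : x ∈ C) : ∃ c : K, σ x = c • 1 :=
    hσ.eq_smul_one_of_mem_of_forall_commute C (fun x hx y hy => hx.2 y hy.1) hx
  let f : B → Module.End K (Module.End K S) := fun x =>
    LinearMap.mulLeft K (σ x) * LinearMap.mulRight K (σ (x : Γ)⁻¹)
  have hf_apply (x : B) (T : Module.End K S) : f x T = σ x * T * σ (x : Γ)⁻¹ := by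
    simp [f, mul_assoc]
  have hf (x y : B) : Commute (f x) (f y) := by
    obtain ⟨c, hc⟩ := hswap x y x.2 y.2
    have hinv : c • (σ (y : Γ)⁻¹ * σ (x : Γ)⁻¹) = σ (x : Γ)⁻¹ * σ (y : Γ)⁻¹ := by
      have h1 : (σ x * σ y) * (σ (y : Γ)⁻¹ * σ (x : Γ)⁻¹) = 1 := by
        rw [← map_mul, ← map_mul, ← map_mul, ← map_one σ]; congr 1; group
      have h2 : (σ (x : Γ)⁻¹ * σ (y : Γ)⁻¹) * (σ y * σ x) = 1 := by
        rw [← map_mul, ← map_mul, ← map_mul, ← map_one σ]; congr 1; group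
      rw [hc, smul_mul_assoc, ← mul_smul_comm] at h1
      calc _ = (σ (x : Γ)⁻¹ * σ (y : Γ)⁻¹) * (σ y * σ x) *
              (c • (σ (y : Γ)⁻¹ * σ (x : Γ)⁻¹)) := by rw [h2, one_mul]
        _ = _ := by rw [mul_assoc, h1, mul_one]
    ext1 T
    change f x (f y T) = f y (f x T)
    rw [hf_apply y T, hf_apply x T, hf_apply, hf_apply]
    calc σ x * (σ y * T * σ (y : Γ)⁻¹) * σ (x : Γ)⁻¹
        = (σ x * σ y) * T * (σ (y : Γ)⁻¹ * σ (x : Γ)⁻¹) := by simp only [mul_assoc]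
      _ = (σ y * σ x) * T * (c • (σ (y : Γ)⁻¹ * σ (x : Γ)⁻¹)) := by
          rw [hc, smul_mul_assoc, smul_mul_assoc, mul_smul_comm]
      _ = σ y * (σ x * T * σ (x : Γ)⁻¹) * σ (y : Γ)⁻¹ := by
          rw [hinv]; simp only [mul_assoc]
  have hweight (x : Γ) (hx : x ∈ B) : ∃ ψ : B → K, ∀ y : B, f y (σ x) = ψ y • σ x := by
    choose ψ hψ using fun y : B => hswap y x y.2 hx
    refine ⟨ψ, fun y => ?_⟩
    rw [hf_apply, hψ, smul_mul_assoc, mul_assoc, σ.apply_mul_cancel, mul_one]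
  have hsame (x y : Γ) (hx : x ∈ B) (hy : y ∈ B) (ψ : B → K)
      (hψx : ∀ z : B, f z (σ x) = ψ z • σ x) (hψy : ∀ z : B, f z (σ y) = ψ z • σ y) :
      ∃ c : K, σ y = c • σ x := by
    have hcomm (w z : Γ) (hz : z ∈ B) (hψ : f ⟨z, hz⟩ (σ w) = ψ ⟨z, hz⟩ • σ w) :
        σ z * σ w = ψ ⟨z, hz⟩ • (σ w * σ z) := by
      rw [← smul_mul_assoc, ← hψ, hf_apply, mul_assoc (σ z * σ w), ← map_mul σ _ z,
        inv_mul_cancel, map_one, mul_one]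
    have hmem : y * x⁻¹ ∈ C := by
      refine ⟨B.mul_mem hy (B.inv_mem hx), fun z hz => ?_⟩
      have h1 := hcomm x z hz (hψx ⟨z, hz⟩)
      have h2 := hcomm y z hz (hψy ⟨z, hz⟩)
      symm
      calc σ z * σ (y * x⁻¹) = σ y * (ψ ⟨z, hz⟩ • (σ z * σ x⁻¹)) := by
            rw [map_mul, ← mul_assoc, h2, smul_mul_assoc, mul_smul_comm, mul_assoc]
        _ = σ y * σ x⁻¹ * (ψ ⟨z, hz⟩ • (σ x * σ z)) * σ x⁻¹ := by
            rw [mul_smul_comm, mul_smul_comm, smul_mul_assoc]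
            simp only [← map_mul]
            congr 2
            group
        _ = σ (y * x⁻¹) * σ z := by
            rw [← h1, mul_assoc, mul_assoc (σ z), σ.apply_mul_cancel, mul_one, map_mul]
    obtain ⟨c, hc⟩ := hC hmem
    refine ⟨c, ?_⟩
    rw [← one_mul (σ x), ← smul_mul_assoc, ← hc, ← map_mul, inv_mul_cancel_right]
  let D : Subgroup Γ :=
    { carrier := {g | σ (g * b * g⁻¹) = σ b}
      one_mem' := by simp
      mul_mem' := fun {g k} hg hk => by
        have e : g * k * b * (g * k)⁻¹ = g * (k * b * k⁻¹) * g⁻¹ := by group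
        change σ _ = _
        rw [e, map_mul, map_mul, hk, ← map_mul, ← map_mul, hg]
      inv_mem' := fun {g} hg => by
        have e : b = g⁻¹ * (g * b * g⁻¹) * g := by group
        change σ _ = _
        rw [inv_inv, map_mul, map_mul, ← show σ (g * b * g⁻¹) = σ b from hg, ← map_mul,
          ← map_mul, ← e]
        exact hg.symm }
  have hD : D.FiniteIndex := by
    refine D.finiteIndex_of_finite_range (fun g => σ (g * b * g⁻¹)) ?_ fun g k hgk => ?_
    · refine (((finite_setOf_weight f hf).biUnion (t := fun ψ => {T : Module.End K S |
          ∃ x ∈ B, (∀ z : B, f z (σ x) = ψ z • σ x) ∧ σ x = T ∧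
            LinearMap.det T = LinearMap.det (σ b)}) fun ψ _ => ?_)).subset ?_
      · by_cases hex : ∃ x ∈ B, ∀ z : B, f z (σ x) = ψ z • σ x
        · obtain ⟨x, hx, hψx⟩ := hex
          refine (finite_setOf_smul_det_eq (σ x) (LinearMap.det (σ b))
            (σ.det_ne_zero x)).subset ?_
          rintro _ ⟨y, hy, hψy, rfl, hdet⟩
          exact ⟨hsame x y hx hy ψ hψx hψy, hdet⟩
        · convert Set.finite_empty
          rw [Set.eq_empty_iff_forall_notMem]
          rintro T ⟨x, hx, hψ, -⟩
          exact hex ⟨x, hx, hψ⟩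
      · rintro _ ⟨g, rfl⟩
        have hx := ‹B.Normal›.conj_mem b hb g
        obtain ⟨ψ, hψ⟩ := hweight _ hx
        refine Set.mem_biUnion (x := ψ) ⟨σ (g * b * g⁻¹), fun h0 => ?_, hψ⟩
          ⟨_, hx, hψ, rfl, ?_⟩
        · have h1 := σ.apply_mul_cancel (g * b * g⁻¹)
          rw [h0, zero_mul] at h1
          exact zero_ne_one h1
        · change LinearMap.det (σ (g * b * g⁻¹)) = _
          rw [map_mul, map_mul, map_mul, map_mul, mul_right_comm, ← map_mul LinearMap.det,
            σ.apply_mul_cancel, map_one, one_mul]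
    · change σ (g⁻¹ * k * b * (g⁻¹ * k)⁻¹) = σ b
      have e1 : g⁻¹ * k * b * (g⁻¹ * k)⁻¹ = g⁻¹ * (k * b * k⁻¹) * g := by group
      have e2 : g⁻¹ * (g * b * g⁻¹) * g = b := by group
      rw [e1, map_mul, map_mul, ← hgk, ← map_mul, ← map_mul, e2]
  refine hσ.eq_smul_one_of_commute D (σ b) fun g hg => ?_
  rw [Commute, SemiconjBy]
  nth_rewrite 2 [← show σ (g * b * g⁻¹) = σ b from hg]
  rw [← map_mul, ← map_mul, inv_mul_cancel_right]

lemma eq_smul_one (hσ : StronglyIrreducible σ) [hΓ : Group.IsSolvable Γ] (g : Γ) :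
    ∃ c : K, σ g = c • 1 := by
  have hstep (k : ℕ) (hk : ∀ x ∈ derivedSeries Γ k, ∃ c : K, σ x = c • 1) :
      ∀ x ∈ derivedSeries Γ 0, ∃ c : K, σ x = c • 1 := by
    induction k with
    | zero => exact hk
    | succ k ih => exact ih fun x hx => hσ.eq_smul_one_of_commutator _ hk hx
  obtain ⟨k, hk⟩ := hΓ.solvable
  refine hstep k (fun x hx => ⟨1, ?_⟩) g (by simp)
  rw [hk, Subgroup.mem_bot] at hx
  rw [hx, map_one, one_smul]

end StronglyIrreducible

end StronglyIrreducible

section Adjoin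

variable (K : Type*) [Field K]

lemma exists_finiteIndex_adjoin_le {G M : Type*} [Group G] [Ring M] [Algebra K M]
    [FiniteDimensional K M] (ρ : G →* M) :
    ∃ H : Subgroup G, H.FiniteIndex ∧ ∀ D ≤ H, D.FiniteIndex →
      Algebra.adjoin K (ρ '' H) ≤ Algebra.adjoin K (ρ '' D) := by
  obtain ⟨H, hH, hmin⟩ := (measure fun H : Subgroup G =>
    Module.finrank K (Algebra.adjoin K (ρ '' (H : Set G)))).wf.has_min
    {H | H.FiniteIndex} ⟨⊤, inferInstanceAs (⊤ : Subgroup G).FiniteIndex⟩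
  refine ⟨H, hH, fun D hDH hD => ?_⟩
  exact (Subalgebra.eq_of_le_of_finrank_le (Algebra.adjoin_mono (Set.image_mono hDH))
    (not_lt.1 (hmin D hD))).ge

variable {K} in
lemma sub_one_mem_jacobson_of_mem_commutator [IsAlgClosed K] {R Γ : Type*} [Ring R] [Algebra K R]
    [FiniteDimensional K R] [Group Γ] [Group.IsSolvable Γ] (ρ : Γ →* R)
    (hρ : ∀ D : Subgroup Γ, D.FiniteIndex → Algebra.adjoin K (ρ '' D) = ⊤) {x : Γ}
    (hx : x ∈ commutator Γ) : ρ x - 1 ∈ Ring.jacobson R := by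
  rw [Ring.jacobson_eq_sInf_isMaximal, Submodule.mem_sInf]
  intro m hm
  let σ : Representation K Γ (R ⧸ m) := (Algebra.lsmul K K (R ⧸ m)).toRingHom.toMonoidHom.comp ρ
  have : Nontrivial (R ⧸ m) := Submodule.Quotient.nontrivial_iff.2 (Ideal.IsMaximal.ne_top hm)
  have : IsSimpleModule R (R ⧸ m) := isSimpleModule_iff_isCoatom.2 (Ideal.isMaximal_def.1 hm)
  have hσ : StronglyIrreducible σ := by
    intro D hD W hW
    let P : Subalgebra K R :=
      { carrier := {r | ∀ v ∈ W, r • v ∈ W}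
        mul_mem' := fun {a b} ha hb v hv => by rw [mul_smul]; exact ha _ (hb v hv)
        add_mem' := fun {a b} ha hb v hv => by rw [add_smul]; exact W.add_mem (ha v hv) (hb v hv)
        algebraMap_mem' := fun c v hv => by rw [algebraMap_smul]; exact W.smul_mem c hv }
    have hP : P = ⊤ := by
      refine top_le_iff.1 ((hρ D hD).ge.trans (Algebra.adjoin_le ?_))
      rintro _ ⟨g, hg, rfl⟩
      exact hW g hg
    let W' : Submodule R (R ⧸ m) :=
      { W with smul_mem' := fun r v hv => (hP ▸ Algebra.mem_top : r ∈ P) v hv }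
    have hmem (v : R ⧸ m) : v ∈ W' ↔ v ∈ W := Iff.rfl
    refine (eq_bot_or_eq_top W').imp (fun h => ?_) fun h => ?_
    · ext v; rw [← hmem, h]; simp
    · ext v; rw [← hmem, h]; simp
  have hker : commutator Γ ≤ (MonoidHom.toHomUnits σ).ker := by
    rw [commutator_def, Subgroup.commutator_le]
    intro g _ h _
    obtain ⟨c, hc⟩ := hσ.eq_smul_one g
    have hcomm : MonoidHom.toHomUnits σ g * MonoidHom.toHomUnits σ h =
        MonoidHom.toHomUnits σ h * MonoidHom.toHomUnits σ g := by
      ext1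
      simp only [Units.val_mul, MonoidHom.coe_toHomUnits, hc, smul_mul_assoc, mul_smul_comm,
        one_mul, mul_one]
    rw [MonoidHom.mem_ker, map_commutatorElement, commutatorElement_eq_one_iff_mul_comm, hcomm]
  have h1 : σ x = 1 := congrArg Units.val (MonoidHom.mem_ker.1 (hker hx))
  have h2 : ρ x • (Submodule.Quotient.mk 1 : R ⧸ m) = Submodule.Quotient.mk 1 :=
    LinearMap.congr_fun h1 _
  rw [← Submodule.Quotient.mk_smul, smul_eq_mul, mul_one] at h2
  exact (Submodule.Quotient.eq m).1 h2

end Adjoin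

lemma exists_central_of_sub_one_mem_jacobson {R Γ : Type*} [Ring R] [IsArtinianRing R] [Group Γ]
    (ρ : Γ →* R) (hρ : Function.Injective ρ) (N : Subgroup Γ)
    (hN : ∀ x ∈ N, ρ x - 1 ∈ Ring.jacobson R) (hbot : N ≠ ⊥) :
    ∃ a ∈ N, a ≠ 1 ∧ ∀ y ∈ N, a * y = y * a := by
  set J := Ring.jacobson R
  obtain ⟨n, hn⟩ := IsSemiprimaryRing.isNilpotent (R := R)
  let P (k : ℕ) : Prop := ∃ x ∈ N, x ≠ 1 ∧ ρ x - 1 ∈ J ^ k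
  have hPn : ¬P n := by
    rintro ⟨x, -, hx1, hx⟩
    rw [hn] at hx
    exact hx1 (hρ (by rw [map_one]; exact sub_eq_zero.1 hx))
  obtain ⟨k, ⟨a, haN, ha1, ha⟩, hk⟩ : ∃ k, P k ∧ ¬P (k + 1) := by
    by_contra! hcon
    refine hPn (Nat.rec ?_ hcon n)
    obtain ⟨x, hx⟩ := Subgroup.ne_bot_iff_exists_ne_one.1 hbot
    refine ⟨x, x.2, by simpa using hx, ?_⟩
    rw [Submodule.pow_zero, Ideal.one_eq_top]
    exact Submodule.mem_top
  refine ⟨a, haN, ha1, fun y hy => ?_⟩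
  rw [← commutatorElement_eq_one_iff_mul_comm]
  by_contra hne
  refine hk ⟨⁅a, y⁆, ?_, hne, ?_⟩
  · exact N.mul_mem (N.mul_mem (N.mul_mem haN hy) (N.inv_mem haN)) (N.inv_mem hy)
  · have e1 : ρ a * ρ y * ρ (a⁻¹ * y⁻¹) = ρ ⁅a, y⁆ := by
      rw [← map_mul, ← map_mul, commutatorElement_def, ← mul_assoc]
    have e2 : ρ y * ρ a * ρ (a⁻¹ * y⁻¹) = 1 := by
      rw [← map_mul, ← map_mul, ← map_one ρ]; congr 1; group
    have e : ρ ⁅a, y⁆ - 1 =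
        ((ρ a - 1) * (ρ y - 1) - (ρ y - 1) * (ρ a - 1)) * ρ (a⁻¹ * y⁻¹) := by
      have e3 : (ρ a - 1) * (ρ y - 1) - (ρ y - 1) * (ρ a - 1) = ρ a * ρ y - ρ y * ρ a := by
        noncomm_ring
      rw [e3, sub_mul, e1, e2]
    rw [e]
    refine Ideal.mul_mem_right _ _ (Ideal.sub_mem _ ?_ ?_)
    · rw [Submodule.pow_succ]; exact Ideal.mul_mem_mul ha (hN y hy)
    · rw [Ideal.IsTwoSided.pow_succ]; exact Ideal.mul_mem_mul (hN y hy) ha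

lemma exists_finiteIndex_commutator_le_centralizer {K : Type*} [Field K] [IsAlgClosed K]
    {G M : Type*} [Group G] [Nontrivial G] [Group.IsSolvable G] [Ring M] [Algebra K M]
    [FiniteDimensional K M] (ρ : G →* M) (hρ : Function.Injective ρ) :
    ∃ H : Subgroup G, H.FiniteIndex ∧ ∃ a ≠ 1, ⁅H, H⁆ ≤ Subgroup.centralizer {a} := by
  obtain ⟨H, hH, hmin⟩ := exists_finiteIndex_adjoin_le K ρ
  refine ⟨H, hH, ?_⟩
  by_cases hbot : commutator H = ⊥
  · obtain ⟨a, ha⟩ := exists_ne (1 : G)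
    refine ⟨a, ha, ?_⟩
    rw [← Subgroup.map_subtype_commutator, hbot, Subgroup.map_bot]
    exact bot_le
  let R := Algebra.adjoin K (ρ '' (H : Set G))
  let τ : H →* R := (ρ.comp H.subtype).codRestrict R
    fun x => Algebra.subset_adjoin ⟨x, x.2, rfl⟩
  have hτ (D : Subgroup H) (hD : D.FiniteIndex) : Algebra.adjoin K (τ '' D) = ⊤ := by
    have hD' : (D.map H.subtype).FiniteIndex :=
      ⟨by rw [Subgroup.index_map_subtype]; exact mul_ne_zero hD.index_ne_zero hH.index_ne_zero⟩
    have hle := hmin _ (Subgroup.map_subtype_le D) hD'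
    apply Subalgebra.map_injective (f := R.val) Subtype.val_injective
    rw [AlgHom.map_adjoin, Algebra.map_top, Subalgebra.range_val]
    have himg : R.val '' (τ '' (D : Set H)) = ρ '' (D.map H.subtype : Subgroup G) := by
      rw [Set.image_image, Subgroup.coe_map, Set.image_image]
      rfl
    rw [himg]
    exact le_antisymm (Algebra.adjoin_mono (Set.image_mono (Subgroup.map_subtype_le D))) hle
  have : IsArtinianRing R := IsArtinianRing.of_finite K R
  obtain ⟨a, -, ha1, ha⟩ := exists_central_of_sub_one_mem_jacobson τ
    (fun x y hxy => Subtype.ext (hρ (congrArg Subtype.val hxy))) (commutator H)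
    (fun x hx => sub_one_mem_jacobson_of_mem_commutator (K := K) τ hτ hx) hbot
  refine ⟨a, by simpa using ha1, ?_⟩
  rw [← Subgroup.map_subtype_commutator]
  rintro _ ⟨y, hy, rfl⟩
  exact Subgroup.mem_centralizer_singleton_iff.2 (congrArg Subtype.val (ha y hy)).symm

theorem stmt18 (G : Type) [Group G] [Countable G] [Infinite G]
    (h : (IsSolvable G ∧ ∃ (n : ℕ) (K : Type) (_ : Field K)
            (φ : G →* Matrix.GeneralLinearGroup (Fin n) K), Function.Injective φ) ∨
        (∃ (N : Subgroup G) (_ : N.Normal), Group.IsNilpotent N ∧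
            ∀ a b : G ⧸ N, a * b = b * a)) :
    ¬ConjTopTransitive G := by
  obtain ⟨hG, n, K, _, φ, hφ⟩ | ⟨N, _, hN, hab⟩ := h
  · have : Group.IsSolvable G := hG
    let ι := algebraMap K (AlgebraicClosure K)
    let ρ : G →* Matrix (Fin n) (Fin n) (AlgebraicClosure K) :=
      (ι.mapMatrix.toMonoidHom).comp ((Units.coeHom _).comp φ)
    have hρ : Function.Injective ρ := fun x y hxy =>
      hφ (Units.ext (Matrix.map_injective ι.injective hxy))
    obtain ⟨H, hH, a, ha, hHa⟩ :=
      exists_finiteIndex_commutator_le_centralizer (K := AlgebraicClosure K) ρ hρ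
    exact not_conjTopTransitive_of_commutator_le_centralizer H a ha hHa
  · have hle : ⁅(⊤ : Subgroup G), ⊤⁆ ≤ N := by
      rw [Subgroup.commutator_le]
      intro x _ y _
      rw [← QuotientGroup.eq_one_iff, ← QuotientGroup.mk'_apply, map_commutatorElement,
        commutatorElement_eq_one_iff_mul_comm]
      exact hab _ _
    obtain rfl | hbot := eq_or_ne N ⊥
    · obtain ⟨a, ha⟩ := exists_ne (1 : G)
      exact not_conjTopTransitive_of_commutator_le_centralizer ⊤ a ha (hle.trans bot_le)
    · have : Nontrivial N := (Subgroup.nontrivial_iff_ne_bot N).2 hbot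
      obtain ⟨⟨a, haZ⟩, ha⟩ := Subgroup.ne_bot_iff_exists_ne_one.1
        (Group.IsNilpotent.center_ne_bot (G := N))
      refine not_conjTopTransitive_of_commutator_le_centralizer ⊤ (a : G)
        (fun h => ha (Subtype.ext (Subtype.ext h))) (hle.trans fun x hx => ?_)
      exact Subgroup.mem_centralizer_singleton_iff.2
        (congrArg Subtype.val (Subgroup.mem_center_iff.1 haZ ⟨x, hx⟩))
end
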